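/- arXiv:2205.13094 — 2 statements merged into one kernel-verified Lean document; each statement's English description precedes it below -/
import Mathlib

section
/- For any positive integer K ≥ 1, the minimax excess risk over the label shift class P_LS is at least (1/(288K))·exp(−n_min/(3K³)). -/
open MeasureTheory Set
open scoped ENNReal Classical

noncomputable section

/-! ## Basic setup: distributions on `ℝ × Bool`, risk, excess risk.

A labelled example is a pair `(x, y) : ℝ × Bool`, where the label `true` codes `+1`
and `false` codes `-1`; features are supported on `[0,1]`. -/

/-- The risk (probability of misclassification) of a classifier `f : ℝ → Bool`
under a distribution `P` on `ℝ × Bool`. -/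
def risk (f : ℝ → Bool) (P : Measure (ℝ × Bool)) : ℝ :=
  (P {p : ℝ × Bool | f p.1 ≠ p.2}).toReal

/-- The Bayes risk of a distribution: the infimum of the risk over all classifiers. -/
def bayesRisk (P : Measure (ℝ × Bool)) : ℝ :=
  ⨅ f : ℝ → Bool, risk f P

/-- The balanced test distribution `P_test = (1/2) P_maj + (1/2) P_min`. -/
def testMeasure (Pmaj Pmin : Measure (ℝ × Bool)) : Measure (ℝ × Bool) :=
  (2 : ℝ≥0∞)⁻¹ • Pmaj + (2 : ℝ≥0∞)⁻¹ • Pmin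

/-- A training sample: `nmaj` labelled points from the majority distribution and
`nmin` labelled points from the minority distribution. -/
abbrev Sample (nmaj nmin : ℕ) : Type :=
  (Fin nmaj → ℝ × Bool) × (Fin nmin → ℝ × Bool)

/-- The law `P_maj^{n_maj} × P_min^{n_min}` of the training sample. -/
def sampleMeasure (nmaj nmin : ℕ) (Pmaj Pmin : Measure (ℝ × Bool)) :
    Measure (Sample nmaj nmin) :=
  (Measure.pi fun _ : Fin nmaj => Pmaj).prod (Measure.pi fun _ : Fin nmin => Pmin)

/-- An algorithm (a map from samples to classifiers) is measurable if the joint map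
`(S, x) ↦ A S x` is measurable. -/
def MeasurableAlg (nmaj nmin : ℕ) (A : Sample nmaj nmin → ℝ → Bool) : Prop :=
  Measurable fun p : Sample nmaj nmin × ℝ => A p.1 p.2

/-- The expected excess risk of the algorithm `A` on the pair `(P_maj, P_min)`:
`E_{S ~ P_maj^{n_maj} × P_min^{n_min}}[R(A^S; P_test)] - R(f^*; P_test)`. -/
def excessRisk (nmaj nmin : ℕ) (A : Sample nmaj nmin → ℝ → Bool)
    (Pmaj Pmin : Measure (ℝ × Bool)) : ℝ :=
  (∫ S, risk (A S) (testMeasure Pmaj Pmin) ∂sampleMeasure nmaj nmin Pmaj Pmin)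
    - bayesRisk (testMeasure Pmaj Pmin)

/-- The distribution on `ℝ × Bool` supported on label `y` whose feature has density `p`
(w.r.t. Lebesgue measure) on `[0,1]`. -/
def labelMeasure (p : ℝ → ℝ) (y : Bool) : Measure (ℝ × Bool) :=
  Measure.map (fun x => (x, y))
    ((volume.restrict (Icc (0:ℝ) 1)).withDensity fun x => ENNReal.ofReal (p x))

/-- The label-shift class `𝒫_LS`: `P_maj(x,y) = P₁(x)·1{y = 1}`,
`P_min(x,y) = P₋₁(x)·1{y = -1}` with `P₁, P₋₁` 1-Lipschitz densities on `[0,1]`. -/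
def memLS (Pmaj Pmin : Measure (ℝ × Bool)) : Prop :=
  ∃ p1 pm1 : ℝ → ℝ,
    (∀ x, 0 ≤ p1 x) ∧ (∀ x, 0 ≤ pm1 x) ∧
    LipschitzOnWith 1 p1 (Icc 0 1) ∧ LipschitzOnWith 1 pm1 (Icc 0 1) ∧
    (∫ x in Icc (0:ℝ) 1, p1 x) = 1 ∧ (∫ x in Icc (0:ℝ) 1, pm1 x) = 1 ∧
    Pmaj = labelMeasure p1 true ∧ Pmin = labelMeasure pm1 false

/-- Total variation distance between two densities on `[0,1]`:
`TV(p, q) = (1/2)∫₀¹ |p - q|`. -/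
def tvDist (p q : ℝ → ℝ) : ℝ :=
  (1/2) * ∫ x in Icc (0:ℝ) 1, |p x - q x|

/-- The distribution on `ℝ × Bool` whose feature has density `p` on `[0,1]` and whose
label is `true` with probability `η x` conditionally on the feature `x`. -/
def covMeasure (p η : ℝ → ℝ) : Measure (ℝ × Bool) :=
  labelMeasure (fun x => p x * η x) true + labelMeasure (fun x => p x * (1 - η x)) false

/-- The group-covariate shift class `𝒫_GS(τ)`: `P_maj(x,y) = P_a(x)·P(y|x)`,
`P_min(x,y) = P_b(x)·P(y|x)` with group densities `P_a, P_b` on `[0,1]`,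
a shared 1-Lipschitz conditional label distribution, and overlap
`1 - TV(P_a, P_b) ≥ τ`. -/
def memGS (τ : ℝ) (Pmaj Pmin : Measure (ℝ × Bool)) : Prop :=
  ∃ pa pb η : ℝ → ℝ,
    (∀ x, 0 ≤ pa x) ∧ (∀ x, 0 ≤ pb x) ∧
    (∫ x in Icc (0:ℝ) 1, pa x) = 1 ∧ (∫ x in Icc (0:ℝ) 1, pb x) = 1 ∧
    (∀ x, 0 ≤ η x ∧ η x ≤ 1) ∧
    LipschitzOnWith 1 η (Icc 0 1) ∧ LipschitzOnWith 1 (fun x => 1 - η x) (Icc 0 1) ∧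
    τ ≤ 1 - tvDist pa pb ∧
    Pmaj = covMeasure pa η ∧ Pmin = covMeasure pb η

/-! ## The hat function -/

/-- The hat function `φ_K`. -/
def hatFun (K : ℕ) (x : ℝ) : ℝ :=
  if x ∈ Icc (-(1/(2*(K:ℝ)))) 0 then |x + 1/(4*(K:ℝ))| - 1/(4*(K:ℝ))
  else if x ∈ Icc (0:ℝ) (1/(2*(K:ℝ))) then 1/(4*(K:ℝ)) - |x - 1/(4*(K:ℝ))|
  else 0

/-! ## The hard family for the label-shift lower bound.

Bins are 0-indexed: `I_j = [j/K, (j+1)/K)` for `j = 0, …, K-1`, corresponding to the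
paper's `I_{j+1} = [((j+1)-1)/K, (j+1)/K]`; the bin center is `(j + 1/2)/K`. -/

/-- The value in `{-1, 0, 1}` coded by an element of `Fin 3`. -/
def trit (i : Fin 3) : ℝ := (i : ℝ) - 1

/-- The perturbed density of the hard label-shift family: on the bin
`I_j = [j/K, (j+1)/K)` it equals `1 + v_j · φ_K(x - (j + 1/2)/K)`. -/
def hardDensityLS (K : ℕ) (v : Fin K → Fin 3) (x : ℝ) : ℝ :=
  1 + ∑ j : Fin K,
    (if x ∈ Ico ((j:ℝ)/(K:ℝ)) (((j:ℝ)+1)/(K:ℝ))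
      then trit (v j) * hatFun K (x - ((j:ℝ) + 1/2)/(K:ℝ)) else 0)

/-- The index set `𝒱 = {-1,0,1}^K × {-1,0,1}^K` of the hard label-shift family. -/
abbrev TritPair (K : ℕ) : Type := (Fin K → Fin 3) × (Fin K → Fin 3)

/-- The law `Q(S | v) = P_{v,maj}^{n_maj} × P_{v,min}^{n_min}` of the sample for the hard
label-shift instance indexed by `v`. -/
def hardLSMeasure (K nmaj nmin : ℕ) (v : TritPair K) : Measure (Sample nmaj nmin) :=
  sampleMeasure nmaj nmin (labelMeasure (hardDensityLS K v.1) true)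
    (labelMeasure (hardDensityLS K v.2) false)

/-- The marginal law `Q_S` of the sample when the index `V` is uniform on `𝒱`. -/
def hardLSMarginal (K nmaj nmin : ℕ) : Measure (Sample nmaj nmin) :=
  ∑ v : TritPair K, (Fintype.card (TritPair K) : ℝ≥0∞)⁻¹ • hardLSMeasure K nmaj nmin v

/-- The posterior weight `Q(v | S)`: the Radon–Nikodym derivative of
`(1/|𝒱|) · Q(S | v)` with respect to `Q_S`, evaluated at `S`. -/
def postLS (K nmaj nmin : ℕ) (v : TritPair K) (S : Sample nmaj nmin) : ℝ :=
  (((Fintype.card (TritPair K) : ℝ≥0∞)⁻¹ • hardLSMeasure K nmaj nmin v).rnDeriv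
      (hardLSMarginal K nmaj nmin) S).toReal

/-- The posterior mixture density `Σ_{v ∈ 𝒱} Q(v | S) · P_{v, ±1}`;
`cls = true` selects the class `+1` densities `P_{v,1}`. -/
def postMixLS (K nmaj nmin : ℕ) (S : Sample nmaj nmin) (cls : Bool) (x : ℝ) : ℝ :=
  ∑ v : TritPair K,
    postLS K nmaj nmin v S * hardDensityLS K (if cls then v.1 else v.2) x

/-! ## The hard family for the group-covariate shift lower bound -/

/-- The sign `+1` / `-1` coded by a Bool. -/
def sgnB (b : Bool) : ℝ := if b then 1 else -1

/-- `P_v(y = 1 | x)` for the hard group-shift family: on the bin `I_j = [j/K, (j+1)/K)` it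
equals `(1/2)(1 + v_j · φ_K(x - (j+1/2)/K))`. -/
def hardEta (K : ℕ) (v : Fin K → Bool) (x : ℝ) : ℝ :=
  (1/2) * (1 + ∑ j : Fin K,
    (if x ∈ Ico ((j:ℝ)/(K:ℝ)) (((j:ℝ)+1)/(K:ℝ))
      then sgnB (v j) * hatFun K (x - ((j:ℝ) + 1/2)/(K:ℝ)) else 0))

/-- The majority-group feature density: `2 - τ` on `[0, 1/2)` and `τ` on `[1/2, 1]`. -/
def hardPa (τ : ℝ) (x : ℝ) : ℝ := if x < 1/2 then 2 - τ else τ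

/-- The minority-group feature density `P_b = 2 - P_a`. -/
def hardPb (τ : ℝ) (x : ℝ) : ℝ := 2 - hardPa τ x

/-- The law `Q(S | v)` of the sample for the hard group-shift instance indexed by `v`. -/
def hardGSMeasure (K nmaj nmin : ℕ) (τ : ℝ) (v : Fin K → Bool) :
    Measure (Sample nmaj nmin) :=
  sampleMeasure nmaj nmin (covMeasure (hardPa τ) (hardEta K v))
    (covMeasure (hardPb τ) (hardEta K v))

/-- The conditional law `Q(S | v_j = b)` of the sample given the `j`-th coordinate of the
uniformly random index: the uniform mixture over all `v` with `v_j = b`. -/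
def condGS (K nmaj nmin : ℕ) (τ : ℝ) (j : Fin K) (b : Bool) :
    Measure (Sample nmaj nmin) :=
  ((Finset.univ.filter fun v : Fin K → Bool => v j = b).card : ℝ≥0∞)⁻¹ •
    ∑ v ∈ Finset.univ.filter (fun v : Fin K → Bool => v j = b),
      hardGSMeasure K nmaj nmin τ v

/-- The Kullback–Leibler divergence `KL(μ ‖ ν) = ∫ log (dμ/dν) dμ`. -/
def klDiv' {α : Type*} [MeasurableSpace α] (μ ν : Measure α) : ℝ :=
  ∫ x, Real.log ((μ.rnDeriv ν x).toReal) ∂μ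

/-! ## The undersampled binning estimator -/

/-- The prediction of the undersampled binning estimator on the bin `I_j = [j/K, (j+1)/K)`
(0-indexed), where `s ⊆ Fin nmaj` is the set of retained majority samples: predict `+1`
iff the samples of the undersampled dataset in the bin with label `+1` strictly
outnumber those with label `-1`. -/
def usbBinPred (nmaj nmin K : ℕ) (s : Finset (Fin nmaj)) (S : Sample nmaj nmin)
    (j : ℕ) : Bool :=
  decide
    ((s.filter fun i => (S.1 i).2 = false ∧
        (S.1 i).1 ∈ Ico ((j:ℝ)/(K:ℝ)) (((j:ℝ)+1)/(K:ℝ))).card +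
      (Finset.univ.filter fun i : Fin nmin => (S.2 i).2 = false ∧
        (S.2 i).1 ∈ Ico ((j:ℝ)/(K:ℝ)) (((j:ℝ)+1)/(K:ℝ))).card
      <
      (s.filter fun i => (S.1 i).2 = true ∧
        (S.1 i).1 ∈ Ico ((j:ℝ)/(K:ℝ)) (((j:ℝ)+1)/(K:ℝ))).card +
      (Finset.univ.filter fun i : Fin nmin => (S.2 i).2 = true ∧
        (S.2 i).1 ∈ Ico ((j:ℝ)/(K:ℝ)) (((j:ℝ)+1)/(K:ℝ))).card)

/-- The undersampled binning classifier `A_USB^{S,K}` with `K` bins, given the retained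
majority samples `s`: on each bin it predicts the majority label among the undersampled
data in that bin. -/
def usbClassifier (nmaj nmin K : ℕ) (s : Finset (Fin nmaj)) (S : Sample nmaj nmin) :
    ℝ → Bool :=
  fun x => usbBinPred nmaj nmin K s S (min ⌊x * (K:ℝ)⌋₊ (K - 1))

/-- The expected excess risk of the undersampled binning estimator with `K` bins, where the
`nmin` retained majority samples are drawn uniformly at random without replacement
(uniformly among all subsets of size `nmin`). -/
def usbExcessRisk (nmaj nmin K : ℕ) (Pmaj Pmin : Measure (ℝ × Bool)) : ℝ :=
  (∑ s ∈ Finset.powersetCard nmin (Finset.univ : Finset (Fin nmaj)),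
      ∫ S, risk (usbClassifier nmaj nmin K s S) (testMeasure Pmaj Pmin)
        ∂sampleMeasure nmaj nmin Pmaj Pmin)
    / ((Finset.powersetCard nmin (Finset.univ : Finset (Fin nmaj))).card : ℝ)
  - bayesRisk (testMeasure Pmaj Pmin)

/-- `q_{j,y} = P(y | x ∈ I_j)` for the 0-indexed bin `I_j = [j/K, (j+1)/K)`. -/
def qBin (P : Measure (ℝ × Bool)) (K j : ℕ) (y : Bool) : ℝ :=
  (P ((Ico ((j:ℝ)/(K:ℝ)) (((j:ℝ)+1)/(K:ℝ))) ×ˢ ({y} : Set Bool))).toReal /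
    (P ((Ico ((j:ℝ)/(K:ℝ)) (((j:ℝ)+1)/(K:ℝ))) ×ˢ (univ : Set Bool))).toReal

/-- The excess risk of the binning estimator in the bin `I_j`:
`R_j(A_USB^S) = q_{j, -A_j^S} - min{q_{j,1}, q_{j,-1}}`. -/
def binExcess (nmaj nmin K : ℕ) (s : Finset (Fin nmaj)) (S : Sample nmaj nmin)
    (P : Measure (ℝ × Bool)) (j : ℕ) : ℝ :=
  qBin P K j (!(usbBinPred nmaj nmin K s S j)) - min (qBin P K j true) (qBin P K j false)

/-- The binomial probability mass function `P[Bin(m, p) = k]`. -/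
def binomPMF (m : ℕ) (p : ℝ) (k : ℕ) : ℝ :=
  (m.choose k : ℝ) * p ^ k * (1 - p) ^ (m - k)
/-! ## Product measures with densities -/

/-- A finite product of measures with a common density is the product measure with the
product density. -/
lemma pi_withDensity_ofReal {α : Type*} [MeasurableSpace α] (n : ℕ) (ν : Measure α)
    [IsFiniteMeasure ν] {g : α → ℝ} (hg0 : ∀ x, 0 ≤ g x) (hgi : Integrable g ν) :
    (Measure.pi fun _ : Fin n => ν.withDensity fun x => ENNReal.ofReal (g x)) =
      (Measure.pi fun _ : Fin n => ν).withDensity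
        fun S => ENNReal.ofReal (∏ i, g (S i)) := by
  have : IsFiniteMeasure (ν.withDensity fun x => ENNReal.ofReal (g x)) :=
    isFiniteMeasure_withDensity_ofReal hgi.hasFiniteIntegral
  refine Measure.pi_eq fun s hs => ?_
  have hint : Integrable (fun S : Fin n → α => ∏ i, g (S i))
      (Measure.pi fun i => ν.restrict (s i)) :=
    Integrable.fintype_prod (f := fun _ => g) fun i => hgi.restrict
  rw [withDensity_apply _ (MeasurableSet.univ_pi hs), Measure.restrict_pi_pi,
    ← ofReal_integral_eq_lintegral_ofReal hint
      (ae_of_all _ fun x => Finset.prod_nonneg fun i _ => hg0 _),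
    integral_fintype_prod_eq_prod (f := fun _ => g),
    ENNReal.ofReal_prod_of_nonneg fun i _ => integral_nonneg hg0]
  refine Finset.prod_congr rfl fun i _ => ?_
  rw [withDensity_apply _ (hs i),
    ofReal_integral_eq_lintegral_ofReal hgi.restrict (ae_of_all _ hg0)]

instance isProbabilityMeasure_volume_restrict_Icc :
    IsProbabilityMeasure (volume.restrict (Icc (0:ℝ) 1)) :=
  ⟨by simp⟩

lemma labelMeasure_one (y : Bool) :
    labelMeasure (fun _ => 1) y =
      Measure.map (fun x => (x, y)) (volume.restrict (Icc (0:ℝ) 1)) := by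
  simp [labelMeasure]

lemma integral_labelMeasure_one {f : ℝ → ℝ} (hf : Measurable f) (y : Bool) :
    ∫ z, f z.1 ∂labelMeasure (fun _ => 1) y = ∫ x in Icc (0:ℝ) 1, f x := by
  rw [labelMeasure_one]
  exact integral_map (by fun_prop) (hf.comp measurable_fst).aestronglyMeasurable

lemma labelMeasure_eq_withDensity {p : ℝ → ℝ} (hp : Measurable p) (y : Bool) :
    labelMeasure p y =
      (labelMeasure (fun _ => 1) y).withDensity fun z => ENNReal.ofReal (p z.1) := by
  ext s hs
  have hm : Measurable fun x : ℝ => (x, y) := by fun_prop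
  rw [labelMeasure_one, withDensity_apply _ hs, setLIntegral_map hs (by fun_prop) hm,
    labelMeasure, Measure.map_apply hm hs, withDensity_apply _ (hm hs)]

lemma isProbabilityMeasure_labelMeasure {p : ℝ → ℝ} (hp0 : ∀ x, 0 ≤ p x)
    (hp1 : ∫ x in Icc (0:ℝ) 1, p x = 1) (y : Bool) :
    IsProbabilityMeasure (labelMeasure p y) := by
  have : IsProbabilityMeasure
      ((volume.restrict (Icc (0:ℝ) 1)).withDensity fun x => ENNReal.ofReal (p x)) := by
    refine ⟨?_⟩
    rw [withDensity_apply _ MeasurableSet.univ, Measure.restrict_univ,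
      ← ofReal_integral_eq_lintegral_ofReal (integrable_of_integral_eq_one hp1)
        (ae_of_all _ hp0), hp1, ENNReal.ofReal_one]
  exact Measure.isProbabilityMeasure_map (by fun_prop)

instance isProbabilityMeasure_labelMeasure_one (y : Bool) :
    IsProbabilityMeasure (labelMeasure (fun _ => 1) y) :=
  isProbabilityMeasure_labelMeasure (fun _ => zero_le_one) (by simp) y

instance isProbabilityMeasure_sampleMeasure (nmaj nmin : ℕ) (P Q : Measure (ℝ × Bool))
    [IsProbabilityMeasure P] [IsProbabilityMeasure Q] :
    IsProbabilityMeasure (sampleMeasure nmaj nmin P Q) := by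
  unfold sampleMeasure; infer_instance

lemma sampleMeasure_labelMeasure_eq_withDensity (nmaj nmin : ℕ) (P : Measure (ℝ × Bool))
    [IsProbabilityMeasure P] {p : ℝ → ℝ} (hp : Measurable p) (hp0 : ∀ x, 0 ≤ p x)
    (hp1 : ∫ x in Icc (0:ℝ) 1, p x = 1) :
    sampleMeasure nmaj nmin P (labelMeasure p false) =
      (sampleMeasure nmaj nmin P (labelMeasure (fun _ => 1) false)).withDensity
        fun S => ENNReal.ofReal (∏ i, p (S.2 i).1) := by
  have hi : Integrable (fun z : ℝ × Bool => p z.1) (labelMeasure (fun _ => 1) false) :=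
    integrable_of_integral_eq_one (by rw [integral_labelMeasure_one hp, hp1])
  rw [sampleMeasure, labelMeasure_eq_withDensity hp,
    pi_withDensity_ofReal nmin _ (g := fun z : ℝ × Bool => p z.1) (fun z => hp0 z.1) hi, prod_withDensity_right (by fun_prop)]
  rfl

/-- The mean of a product statistic of the minority sample. -/
lemma integral_prod_sampleMeasure (nmaj nmin : ℕ) (P : Measure (ℝ × Bool))
    [IsProbabilityMeasure P] {f : ℝ → ℝ} (hf : Measurable f) :
    ∫ S, ∏ i, f (S.2 i).1 ∂sampleMeasure nmaj nmin P (labelMeasure (fun _ => 1) false) =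
      (∫ x in Icc (0:ℝ) 1, f x) ^ nmin := by
  rw [sampleMeasure, integral_fun_snd (fun S : Fin nmin → ℝ × Bool => ∏ i, f (S i).1),
    integral_fintype_prod_eq_pow (fun z : ℝ × Bool => f z.1), integral_labelMeasure_one hf]
  simp

/-- Le Cam's bound: the overlap of two densities is at least half the square of the mean of
any minorant of their geometric mean. -/
lemma half_sq_integral_le_integral_min {Ω : Type*} [MeasurableSpace Ω] {M : Measure Ω}
    {D E R : Ω → ℝ} (hD : ∫ S, D S ∂M = 1) (hE : ∫ S, E S ∂M = 1)
    (hD0 : ∀ S, 0 ≤ D S) (hE0 : ∀ S, 0 ≤ E S) (hR : ∀ S, R S ^ 2 ≤ D S * E S)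
    (hRi : Integrable R M) (hρ : 0 < ∫ S, R S ∂M) :
    (∫ S, R S ∂M) ^ 2 / 2 ≤ ∫ S, min (D S) (E S) ∂M := by
  have hDi := integrable_of_integral_eq_one hD
  have hEi := integrable_of_integral_eq_one hE
  have hmi : Integrable (fun S => min (D S) (E S)) M := hDi.inf hEi
  set ρ := ∫ S, R S ∂M with hρdef
  have key : ∀ S, R S ≤ ρ⁻¹ * min (D S) (E S) + ρ / 4 * (D S + E S) := by
    intro S
    have hm0 : 0 ≤ min (D S) (E S) := le_min (hD0 S) (hE0 S)
    have hmM : R S ^ 2 ≤ min (D S) (E S) * (D S + E S) := by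
      refine (hR S).trans ?_
      rw [← min_mul_max (D S) (E S)]
      exact mul_le_mul_of_nonneg_left
        (max_le (by linarith [hE0 S]) (by linarith [hD0 S])) hm0
    have hs : R S ^ 2 ≤ (ρ⁻¹ * min (D S) (E S) + ρ / 4 * (D S + E S)) ^ 2 := by
      refine hmM.trans ?_
      have h1 : min (D S) (E S) * (D S + E S) =
          4 * ((ρ⁻¹ * min (D S) (E S)) * (ρ / 4 * (D S + E S))) := by
        field_simp
      rw [h1]
      nlinarith [sq_nonneg (ρ⁻¹ * min (D S) (E S) - ρ / 4 * (D S + E S))]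
    exact (abs_le.mp <| abs_le_of_sq_le_sq hs (by have := hD0 S; have := hE0 S; positivity)).2
  have hint := integral_mono hRi
    ((hmi.const_mul ρ⁻¹).add ((hDi.add hEi).const_mul (ρ / 4))) key
  rw [integral_add' (hmi.const_mul ρ⁻¹) ((hDi.add hEi).const_mul (ρ / 4)),
    integral_const_mul, integral_const_mul] at hint
  simp only [Pi.add_apply] at hint
  rw [integral_add hDi hEi, hD, hE, ← hρdef] at hint
  have h2 : ρ / 2 ≤ ρ⁻¹ * ∫ S, min (D S) (E S) ∂M := by linarith
  have h3 := mul_le_mul_of_nonneg_left h2 hρ.le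
  rw [← mul_assoc, mul_inv_cancel₀ hρ.ne', one_mul] at h3
  linarith

/-! ## The perturbed densities -/

/-- The index of the bin `[j/K, (j+1)/K)` containing `x ∈ [0, 1)`. -/
def binIdx (K : ℕ) [NeZero K] (x : ℝ) : Fin K := Fin.ofNat K ⌊(K:ℝ) * x⌋₊

/-- The sinusoidal perturbation `sin(2πKx)/(2πK)`, of period `1/K`. -/
def bump (K : ℕ) (x : ℝ) : ℝ := Real.sin (2 * Real.pi * K * x) / (2 * Real.pi * K)

/-- The density `1 + ε_j · bump` on the `j`-th bin. -/
def bumpDensity (K : ℕ) [NeZero K] (ε : Fin K → Bool) (x : ℝ) : ℝ :=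
  1 + sgnB (ε (binIdx K x)) * bump K x

lemma sgnB_not (b : Bool) : sgnB (!b) = -sgnB b := by cases b <;> simp [sgnB]

lemma abs_sgnB (b : Bool) : |sgnB b| = 1 := by cases b <;> simp [sgnB]

lemma continuous_bump (K : ℕ) : Continuous (bump K) := by unfold bump; fun_prop

lemma abs_sgnB_mul_bump (K : ℕ) (b : Bool) (x : ℝ) : |sgnB b * bump K x| = |bump K x| := by
  rw [abs_mul, abs_sgnB, one_mul]

section Bump

variable (K : ℕ) [NeZero K]

lemma cast_pos_of_neZero : (0:ℝ) < K := Nat.cast_pos.mpr (NeZero.pos K)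

lemma measurable_binIdx : Measurable (binIdx K) :=
  (measurable_from_nat (f := Fin.ofNat K)).comp
    (Nat.measurable_floor.comp (measurable_const_mul _))

lemma measurable_bumpDensity (ε : Fin K → Bool) : Measurable (bumpDensity K ε) :=
  measurable_const.add (((measurable_from_top (f := fun j => sgnB (ε j))).comp
    (measurable_binIdx K)).mul (continuous_bump K).measurable)

lemma six_lt_two_pi_mul : 6 < 2 * Real.pi * K := by
  have hK : (1:ℝ) ≤ K := Nat.one_le_cast.mpr (NeZero.pos K)
  nlinarith [Real.pi_gt_three]

lemma abs_bump_le (x : ℝ) : |bump K x| ≤ 1 / 2 := by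
  have h6 := six_lt_two_pi_mul K
  rw [bump, abs_div, abs_of_pos (a := 2 * Real.pi * (K:ℝ)) (by linarith),
    div_le_iff₀ (by linarith)]
  linarith [Real.abs_sin_le_one (2 * Real.pi * K * x)]

lemma bumpDensity_bounds (ε : Fin K → Bool) (x : ℝ) :
    0 ≤ bumpDensity K ε x ∧ bumpDensity K ε x ≤ 2 := by
  have h := abs_le.mp ((abs_sgnB_mul_bump K (ε (binIdx K x)) x).trans_le (abs_bump_le K x))
  constructor <;> unfold bumpDensity <;> linarith [h.1, h.2]

lemma abs_bump_sub_le (x y : ℝ) : |bump K x - bump K y| ≤ |x - y| := by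
  have h6 := six_lt_two_pi_mul K
  have hpos : 0 < 2 * Real.pi * (K:ℝ) := by linarith
  rw [bump, bump, ← sub_div, abs_div, abs_of_pos hpos, div_le_iff₀ hpos]
  calc _ ≤ |2 * Real.pi * K * x - 2 * Real.pi * K * y| := Real.abs_sin_sub_sin_le _ _
    _ = |x - y| * (2 * Real.pi * K) := by
      rw [← mul_sub, abs_mul, abs_of_pos hpos, mul_comm]

lemma bump_nat_div (m : ℕ) : bump K (m / K) = 0 := by
  have hK := cast_pos_of_neZero K
  have : 2 * Real.pi * K * (m / K) = (2 * m : ℕ) * Real.pi := by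
    push_cast; field_simp
  rw [bump, this, Real.sin_nat_mul_pi, zero_div]

lemma lipschitzOnWith_bumpDensity (ε : Fin K → Bool) :
    LipschitzOnWith 1 (bumpDensity K ε) (Icc 0 1) := by
  have hK := cast_pos_of_neZero K
  suffices h : ∀ x y : ℝ, 0 ≤ x → x ≤ y →
      |bumpDensity K ε x - bumpDensity K ε y| ≤ y - x by
    refine LipschitzOnWith.of_dist_le_mul fun x hx y hy => ?_
    rw [Real.dist_eq, Real.dist_eq, NNReal.coe_one, one_mul]
    rcases le_total x y with hxy | hxy
    · rw [abs_sub_comm x y, abs_of_nonneg (sub_nonneg.mpr hxy)]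
      exact h x y hx.1 hxy
    · rw [abs_sub_comm, abs_of_nonneg (sub_nonneg.mpr hxy)]
      exact h y x hy.1 hxy
  intro x y hx hxy
  by_cases hb : ⌊(K:ℝ) * x⌋₊ = ⌊(K:ℝ) * y⌋₊
  · have hb' : binIdx K x = binIdx K y := by rw [binIdx, binIdx, hb]
    rw [bumpDensity, bumpDensity, hb', add_sub_add_left_eq_sub, ← mul_sub, abs_mul, abs_sgnB,
      one_mul]
    refine (abs_bump_sub_le K x y).trans_eq ?_
    rw [abs_sub_comm, abs_of_nonneg (sub_nonneg.mpr hxy)]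
  · have hy0 : 0 ≤ (K:ℝ) * y := mul_nonneg hK.le (hx.trans hxy)
    set z : ℝ := (⌊(K:ℝ) * y⌋₊ : ℝ) / K with hz
    have hzy : z ≤ y := by
      rw [hz, div_le_iff₀ hK, mul_comm y]; exact Nat.floor_le hy0
    have hxz : x ≤ z := by
      rw [hz, le_div_iff₀ hK, mul_comm x]
      by_contra hlt
      push Not at hlt
      exact hb (le_antisymm (Nat.floor_mono (by gcongr)) (Nat.le_floor hlt.le))
    have hz0 : bump K z = 0 := bump_nat_div K _
    have h1 := abs_bump_sub_le K x z
    have h2 := abs_bump_sub_le K y z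
    rw [hz0, sub_zero, ← abs_sgnB_mul_bump K (ε (binIdx K x)), abs_sub_comm,
      abs_of_nonneg (sub_nonneg.mpr hxz)] at h1
    rw [hz0, sub_zero, ← abs_sgnB_mul_bump K (ε (binIdx K y)),
      abs_of_nonneg (sub_nonneg.mpr hzy)] at h2
    rw [bumpDensity, bumpDensity, add_sub_add_left_eq_sub]
    refine (abs_sub _ _).trans ?_
    linarith

lemma integrableOn_comp_binIdx_mul (c : Fin K → ℝ) {g : ℝ → ℝ} (hg : Continuous g) (a b : ℝ) :
    IntegrableOn (fun x => c (binIdx K x) * g x) (Icc a b) :=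
  (hg.continuousOn.integrableOn_Icc (μ := volume)).bdd_mul (c := ∑ j, |c j|)
    (((measurable_from_top (f := c)).comp (measurable_binIdx K)).aestronglyMeasurable)
    (ae_of_all _ fun _ =>
      Finset.single_le_sum (f := fun j => |c j|) (fun _ _ => abs_nonneg _) (Finset.mem_univ _))

/-- Integrating a function that is, on each bin, a multiple of a function with the same
integral over all bins. -/
lemma integral_comp_binIdx_mul (c : Fin K → ℝ) {g : ℝ → ℝ} (hg : Continuous g) {J : ℝ}
    (hJ : ∀ j : ℕ, ∫ x in ((j:ℝ) / K)..((j + 1 : ℕ) : ℝ) / K, g x = J) :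
    ∫ x in Icc (0:ℝ) 1, c (binIdx K x) * g x = (∑ j, c j) * J := by
  have hK := cast_pos_of_neZero K
  have hle : ∀ j : ℕ, (j:ℝ) / K ≤ ((j + 1 : ℕ) : ℝ) / K := fun j => by
    gcongr; exact Nat.le_succ j
  have hsum := intervalIntegral.sum_integral_adjacent_intervals (μ := volume) (n := K)
    (a := fun j : ℕ => (j:ℝ) / K) (f := fun x => c (binIdx K x) * g x)
    fun j _ => (intervalIntegrable_iff_integrableOn_Icc_of_le (hle j)).mpr
      (integrableOn_comp_binIdx_mul K c hg _ _)
  rw [Nat.cast_zero, zero_div, div_self hK.ne'] at hsum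
  rw [integral_Icc_eq_integral_Ioc, ← intervalIntegral.integral_of_le zero_le_one, ← hsum,
    Finset.sum_range, Finset.sum_mul]
  refine Finset.sum_congr rfl fun j _ => ?_
  rw [← hJ j, ← intervalIntegral.integral_const_mul]
  refine intervalIntegral.integral_congr_Ioo_of_le (hle j) fun x hx => ?_
  have hfl : ⌊(K:ℝ) * x⌋₊ = j := by
    have h1 := (div_lt_iff₀ hK).mp hx.1
    have h2 := (lt_div_iff₀ hK).mp hx.2
    push_cast at h2
    rw [mul_comm] at h1 h2
    exact (Nat.floor_eq_iff (by linarith [(Nat.cast_nonneg (j:ℕ) : (0:ℝ) ≤ _)])).mpr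
      ⟨h1.le, h2⟩
  have hb : binIdx K x = j := by
    rw [binIdx, hfl]; ext; simp
  simp only [hb]

lemma integral_bump (j : ℕ) : ∫ x in ((j:ℝ) / K)..((j + 1 : ℕ) : ℝ) / K, bump K x = 0 := by
  have hK := cast_pos_of_neZero K
  have h6 := six_lt_two_pi_mul K
  have hc : ∀ m : ℕ, Real.cos (2 * Real.pi * K * (m / K)) = 1 := fun m => by
    rw [← Real.cos_nat_mul_two_pi m]; congr 1; field_simp
  unfold bump
  rw [intervalIntegral.integral_div,
    intervalIntegral.integral_comp_mul_left (fun x => Real.sin x) (by linarith : _ ≠ (0:ℝ)),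
    integral_sin, hc, hc]
  simp

lemma integral_bump_sq (j : ℕ) :
    ∫ x in ((j:ℝ) / K)..((j + 1 : ℕ) : ℝ) / K, bump K x ^ 2 =
      1 / (8 * Real.pi ^ 2 * K ^ 3) := by
  have hK := cast_pos_of_neZero K
  have h6 := six_lt_two_pi_mul K
  have hs : ∀ m : ℕ, Real.sin (2 * Real.pi * K * (m / K)) = 0 := fun m => by
    rw [← Real.sin_nat_mul_pi (2 * m)]; congr 1; push_cast; field_simp
  simp_rw [bump, div_pow]
  rw [intervalIntegral.integral_div,
    intervalIntegral.integral_comp_mul_left (fun x => Real.sin x ^ 2)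
      (by linarith : 2 * Real.pi * (K:ℝ) ≠ 0), integral_sin_sq, hs, hs]
  have := Real.pi_pos
  push_cast
  simp only [smul_eq_mul]
  field_simp
  ring

lemma integral_bumpDensity (ε : Fin K → Bool) :
    ∫ x in Icc (0:ℝ) 1, bumpDensity K ε x = 1 := by
  unfold bumpDensity
  rw [integral_add (integrable_const _)
    (integrableOn_comp_binIdx_mul K (fun j => sgnB (ε j)) (continuous_bump K) 0 1),
    integral_comp_binIdx_mul K (fun j => sgnB (ε j)) (continuous_bump K) (integral_bump K)]
  simp

lemma integral_abs_bump_ge : 1 / (4 * Real.pi * K) ≤ ∫ x in Icc (0:ℝ) 1, |bump K x| := by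
  have hK := cast_pos_of_neZero K
  have hpi := Real.pi_pos
  have h6 := six_lt_two_pi_mul K
  have hpos : 0 < 2 * Real.pi * (K:ℝ) := by linarith
  have hcont : Continuous fun x => bump K x ^ 2 := (continuous_bump K).pow 2
  have hsq := integral_comp_binIdx_mul K (fun _ => 2 * Real.pi * (K:ℝ)) hcont
    (integral_bump_sq K)
  have hval : (∑ _j : Fin K, 2 * Real.pi * (K:ℝ)) * (1 / (8 * Real.pi ^ 2 * K ^ 3)) =
      1 / (4 * Real.pi * K) := by
    simp only [Finset.sum_const, Finset.card_univ, Fintype.card_fin, nsmul_eq_mul]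
    field_simp
    ring
  rw [← hval, ← hsq]
  refine integral_mono (integrableOn_comp_binIdx_mul K (fun _ => _) hcont 0 1)
    ((continuous_bump K).abs.continuousOn.integrableOn_Icc) fun x => ?_
  have hb : 2 * Real.pi * K * |bump K x| ≤ 1 := by
    rw [bump, abs_div, abs_of_pos hpos, mul_div_cancel₀ _ hpos.ne']
    exact Real.abs_sin_le_one _
  show 2 * Real.pi * K * bump K x ^ 2 ≤ |bump K x|
  rw [← sq_abs]
  nlinarith [abs_nonneg (bump K x)]

/-- The overlap of two perturbed densities whose sign patterns differ in one bin, after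
taking `n` samples. -/
lemma exists_sq_le_bumpDensity_mul (ε : Fin K → Bool) (j : Fin K) :
    ∃ r : ℝ → ℝ, Measurable r ∧ (∀ x, 0 ≤ r x) ∧
      (∀ x, r x ^ 2 ≤ bumpDensity K ε x * bumpDensity K (Function.update ε j (!ε j)) x) ∧
      ∫ x in Icc (0:ℝ) 1, r x = 1 - 1 / (8 * Real.pi ^ 2 * K ^ 3) := by
  have hcont : Continuous fun x => bump K x ^ 2 := (continuous_bump K).pow 2
  set c₁ : Fin K → ℝ := fun i => if i = j then 0 else sgnB (ε i)
  set c₂ : Fin K → ℝ := fun i => if i = j then 1 else 0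
  have hval : ∀ x, 1 + c₁ (binIdx K x) * bump K x - c₂ (binIdx K x) * bump K x ^ 2 =
      if binIdx K x = j then 1 - bump K x ^ 2 else bumpDensity K ε x := fun x => by
    by_cases h : binIdx K x = j <;> simp [c₁, c₂, h, bumpDensity]
  have hb : ∀ x, bump K x ^ 2 ≤ 1 := fun x => by
    rw [← sq_abs]; nlinarith [abs_bump_le K x, abs_nonneg (bump K x)]
  refine ⟨fun x => 1 + c₁ (binIdx K x) * bump K x - c₂ (binIdx K x) * bump K x ^ 2,
    ?_, fun x => ?_, fun x => ?_, ?_⟩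
  · have := (continuous_bump K).measurable
    have h := measurable_binIdx K
    have h₁ := (measurable_from_top (f := c₁)).comp h
    have h₂ := (measurable_from_top (f := c₂)).comp h
    exact (measurable_const.add (h₁.mul this)).sub (h₂.mul (this.pow_const 2))
  · simp only [hval]
    split_ifs
    · linarith [hb x]
    · exact (bumpDensity_bounds K ε x).1
  · simp only [hval]
    split_ifs with h
    · rw [bumpDensity, bumpDensity, h, Function.update_self, sgnB_not]
      have hs : sgnB (ε j) ^ 2 = 1 := by rw [← sq_abs, abs_sgnB, one_pow]
      nlinarith [hb x, sq_nonneg (bump K x)]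
    · rw [bumpDensity, bumpDensity, Function.update_of_ne h, sq]
  · have h1 := integrableOn_comp_binIdx_mul K c₁ (continuous_bump K) 0 1
    have h2 := integrableOn_comp_binIdx_mul K c₂ hcont 0 1
    have h0 : IntegrableOn (fun x => 1 + c₁ (binIdx K x) * bump K x) (Icc 0 1) volume :=
      (integrable_const 1).add h1
    rw [integral_sub h0 h2, integral_add (integrable_const _) h1,
      integral_comp_binIdx_mul K c₁ (continuous_bump K) (integral_bump K),
      integral_comp_binIdx_mul K c₂ hcont (integral_bump_sq K)]
    simp [c₂]

end Bump

/-! ## Risk of classifiers -/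

/-- The indicator of the label `+1`. -/
def labelInd (b : Bool) : ℝ := if b then 1 else 0

lemma measurable_labelInd : Measurable labelInd := measurable_from_top

lemma labelInd_nonneg (b : Bool) : 0 ≤ labelInd b := by cases b <;> simp [labelInd]

lemma labelInd_le_one (b : Bool) : labelInd b ≤ 1 := by cases b <;> simp [labelInd]

lemma labelMeasure_real_apply {p : ℝ → ℝ} (hp0 : ∀ x, 0 ≤ p x)
    (hpi : IntegrableOn p (Icc 0 1)) {f : ℝ → Bool} (hf : Measurable f) (y : Bool) :
    (labelMeasure p y {z | f z.1 ≠ z.2}).toReal =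
      ∫ x in Icc (0:ℝ) 1, if f x = y then 0 else p x := by
  have hs : MeasurableSet {x | f x ≠ y} := hf (MeasurableSet.of_discrete (s := {b | b ≠ y}))
  have hs' : MeasurableSet {z : ℝ × Bool | f z.1 ≠ z.2} :=
    (measurableSet_eq_fun (hf.comp measurable_fst) measurable_snd).compl
  rw [labelMeasure, Measure.map_apply (by fun_prop) hs']
  change ((volume.restrict (Icc (0:ℝ) 1)).withDensity _ {x | f x ≠ y}).toReal = _
  rw [withDensity_apply _ hs,
    ← ofReal_integral_eq_lintegral_ofReal (Integrable.restrict hpi) (ae_of_all _ hp0),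
    ENNReal.toReal_ofReal (integral_nonneg hp0), ← integral_indicator hs]
  refine integral_congr_ae (ae_of_all _ fun x => ?_)
  by_cases h : f x = y <;> simp [Set.indicator, h]

instance isProbabilityMeasure_testMeasure (P Q : Measure (ℝ × Bool))
    [IsProbabilityMeasure P] [IsProbabilityMeasure Q] :
    IsProbabilityMeasure (testMeasure P Q) :=
  ⟨by simp [testMeasure, ENNReal.inv_two_add_inv_two]⟩

lemma risk_nonneg (f : ℝ → Bool) (P : Measure (ℝ × Bool)) : 0 ≤ risk f P :=
  ENNReal.toReal_nonneg

lemma risk_le_one (f : ℝ → Bool) (P : Measure (ℝ × Bool)) [IsProbabilityMeasure P] :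
    risk f P ≤ 1 :=
  measureReal_le_one

lemma bayesRisk_le (f : ℝ → Bool) (P : Measure (ℝ × Bool)) : bayesRisk P ≤ risk f P :=
  ciInf_le ⟨0, by rintro _ ⟨g, rfl⟩; exact risk_nonneg g P⟩ f

lemma excessRisk_le_one {nmaj nmin : ℕ} (A : Sample nmaj nmin → ℝ → Bool)
    {P Q : Measure (ℝ × Bool)} (h : memLS P Q) : excessRisk nmaj nmin A P Q ≤ 1 := by
  obtain ⟨p, q, hp0, hq0, -, -, hp1, hq1, rfl, rfl⟩ := h
  have := isProbabilityMeasure_labelMeasure hp0 hp1 true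
  have := isProbabilityMeasure_labelMeasure hq0 hq1 false
  have hb : 0 ≤ bayesRisk (testMeasure (labelMeasure p true) (labelMeasure q false)) :=
    Real.iInf_nonneg fun f => risk_nonneg f _
  have hn := norm_integral_le_of_norm_le_const (C := 1)
    (μ := sampleMeasure nmaj nmin (labelMeasure p true) (labelMeasure q false))
    (f := fun S => risk (A S) (testMeasure (labelMeasure p true) (labelMeasure q false)))
    (ae_of_all _ fun S => by
      rw [Real.norm_of_nonneg (risk_nonneg _ _)]; exact risk_le_one _ _)
  rw [probReal_univ, mul_one] at hn
  have := (Real.le_norm_self _).trans hn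
  unfold excessRisk
  linarith

/-- The risk when the class `+1` is uniform, relative to the classifier that always
answers `-1`. -/
lemma risk_testMeasure {p : ℝ → ℝ} (hp0 : ∀ x, 0 ≤ p x)
    (hp1 : ∫ x in Icc (0:ℝ) 1, p x = 1) {f : ℝ → Bool} (hf : Measurable f) :
    risk f (testMeasure (labelMeasure (fun _ => 1) true) (labelMeasure p false)) =
      1 / 2 + 1 / 2 * ∫ x in Icc (0:ℝ) 1, labelInd (f x) * (p x - 1) := by
  have hpi : IntegrableOn p (Icc 0 1) := integrable_of_integral_eq_one hp1
  have := isProbabilityMeasure_labelMeasure hp0 hp1 false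
  have hm : Measurable fun x => labelInd (f x) := measurable_labelInd.comp hf
  have hi : IntegrableOn (fun x => labelInd (f x) * (p x - 1)) (Icc 0 1) :=
    Integrable.bdd_mul (c := 1) (hpi.sub (integrable_const 1)) hm.aestronglyMeasurable
      (ae_of_all _ fun x => by
        rw [Real.norm_of_nonneg (labelInd_nonneg _)]; exact labelInd_le_one _)
  have h1 : IntegrableOn (fun x => if f x = true then (0:ℝ) else 1) (Icc 0 1) := by
    refine Integrable.of_bound (C := 1) ?_ (ae_of_all _ fun x => by split_ifs <;> simp)
    exact ((measurable_from_top (f := fun b : Bool => if b = true then (0:ℝ) else 1)).comp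
      hf).aestronglyMeasurable
  have h2 : IntegrableOn (fun x => if f x = false then (0:ℝ) else p x) (Icc 0 1) := by
    have : (fun x => if f x = false then (0:ℝ) else p x) =
        fun x => labelInd (f x) * (p x - 1) + labelInd (f x) := by
      ext x; cases h : f x <;> simp [labelInd]
    rw [this]
    exact hi.add (Integrable.of_bound (C := 1) hm.aestronglyMeasurable
      (ae_of_all _ fun x => by
        rw [Real.norm_of_nonneg (labelInd_nonneg _)]; exact labelInd_le_one _))
  have hsum : (∫ x in Icc (0:ℝ) 1, if f x = true then (0:ℝ) else 1) +
      (∫ x in Icc (0:ℝ) 1, if f x = false then (0:ℝ) else p x) =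
      1 + ∫ x in Icc (0:ℝ) 1, labelInd (f x) * (p x - 1) := by
    have hadd := integral_add (μ := volume.restrict (Icc (0:ℝ) 1)) (integrable_const (1:ℝ)) hi
    rw [integral_const, probReal_univ, one_smul] at hadd
    rw [← integral_add h1 h2, ← hadd]
    refine integral_congr_ae (ae_of_all _ fun x => ?_)
    cases h : f x <;> simp [labelInd, h]
  rw [← labelMeasure_real_apply (fun _ => zero_le_one) (integrable_const 1) hf true,
    ← labelMeasure_real_apply hp0 hpi hf false] at hsum
  rw [risk, testMeasure, Measure.add_apply, Measure.smul_apply, Measure.smul_apply,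
    ENNReal.toReal_add (by simp [ENNReal.mul_eq_top]) (by simp [ENNReal.mul_eq_top])]
  simp only [smul_eq_mul, ENNReal.toReal_mul, ENNReal.toReal_inv, ENNReal.toReal_ofNat]
  linarith

/-- The excess risk is at least the expected disagreement cost with any fixed classifier. -/
lemma integral_le_excessRisk {nmaj nmin : ℕ} {A : Sample nmaj nmin → ℝ → Bool}
    (hA : MeasurableAlg nmaj nmin A) {p : ℝ → ℝ} (hp0 : ∀ x, 0 ≤ p x)
    (hp1 : ∫ x in Icc (0:ℝ) 1, p x = 1) {f : ℝ → Bool} (hf : Measurable f) :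
    1 / 2 * ∫ S, (∫ x in Icc (0:ℝ) 1, (labelInd (A S x) - labelInd (f x)) * (p x - 1))
        ∂sampleMeasure nmaj nmin (labelMeasure (fun _ => 1) true) (labelMeasure p false) ≤
      excessRisk nmaj nmin A (labelMeasure (fun _ => 1) true) (labelMeasure p false) := by
  have := isProbabilityMeasure_labelMeasure hp0 hp1 false
  have hpi : IntegrableOn (fun x => p x - 1) (Icc 0 1) :=
    (integrable_of_integral_eq_one hp1).sub (integrable_const 1)
  have hAS : ∀ S, Measurable (A S) := fun S => hA.comp measurable_prodMk_left
  have hg : ∀ g : ℝ → Bool, Measurable g →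
      IntegrableOn (fun x => labelInd (g x) * (p x - 1)) (Icc 0 1) := fun g hg =>
    Integrable.bdd_mul (c := 1) hpi (measurable_labelInd.comp hg).aestronglyMeasurable
      (ae_of_all _ fun x => by
        rw [Real.norm_of_nonneg (labelInd_nonneg _)]; exact labelInd_le_one _)
  set μ := sampleMeasure nmaj nmin (labelMeasure (fun _ => 1) true) (labelMeasure p false)
  set T := testMeasure (labelMeasure (fun _ => 1) true) (labelMeasure p false)
  have hdiff : ∀ S, 1 / 2 * ∫ x in Icc (0:ℝ) 1,
      (labelInd (A S x) - labelInd (f x)) * (p x - 1) = risk (A S) T - risk f T := by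
    intro S
    rw [risk_testMeasure hp0 hp1 (hAS S), risk_testMeasure hp0 hp1 hf]
    simp_rw [sub_mul]
    rw [integral_sub (hg _ (hAS S)) (hg _ hf)]
    ring
  have hmeas : Measurable fun S => risk (A S) T := by
    have hs : MeasurableSet {q : Sample nmaj nmin × (ℝ × Bool) | A q.1 q.2.1 ≠ q.2.2} :=
      (measurableSet_eq_fun (hA.comp (by fun_prop :
        Measurable fun q : Sample nmaj nmin × (ℝ × Bool) => (q.1, q.2.1)))
        (by fun_prop)).compl
    exact (measurable_measure_prodMk_left hs).ennreal_toReal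
  have hint : Integrable (fun S => risk (A S) T) μ :=
    Integrable.of_bound (C := 1) hmeas.aestronglyMeasurable (ae_of_all _ fun S => by
      rw [Real.norm_of_nonneg (risk_nonneg _ _)]; exact risk_le_one _ _)
  rw [← integral_const_mul]
  simp_rw [hdiff]
  rw [integral_sub hint (integrable_const _), integral_const, probReal_univ, one_smul,
    excessRisk]
  linarith [bayesRisk_le f T]

/-! ## Averaging over the sign patterns -/

lemma sum_comp_update_not {K : ℕ} (j : Fin K) (G : (Fin K → Bool) → ℝ) :
    ∑ ε, G (Function.update ε j (!ε j)) = ∑ ε, G ε := by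
  have hinv : Function.Involutive fun ε : Fin K → Bool => Function.update ε j (!ε j) := by
    intro ε; simp
  exact Equiv.sum_comp hinv.toPerm G

/-- The cost of the label `a`, relative to the Bayes label, under two hypotheses with opposite
Bayes labels. -/
lemma abs_mul_min_le (a : Bool) (u D E : ℝ) :
    |u| * min D E ≤
      D * ((labelInd a - labelInd (if u ≤ 0 then true else false)) * u) +
        E * ((labelInd a - labelInd (if -u ≤ 0 then true else false)) * -u) := by
  have h1 := min_le_left D E
  have h2 := min_le_right D E
  rcases lt_trichotomy u 0 with hu | rfl | hu
  · rw [abs_of_neg hu, if_pos hu.le, if_neg (by linarith)]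
    cases a <;> simp only [labelInd, Bool.false_eq_true, if_true, if_false] <;> nlinarith
  · simp
  · rw [abs_of_pos hu, if_neg (by linarith), if_pos (by linarith)]
    cases a <;> simp only [labelInd, Bool.false_eq_true, if_true, if_false] <;> nlinarith

section Average

variable (K : ℕ) [NeZero K]

/-- The likelihood ratio of the minority sample under `bumpDensity K ε` with respect to the
uniform density. -/
def likelihood (ε : Fin K → Bool) {nmaj nmin : ℕ} (S : Sample nmaj nmin) : ℝ :=
  ∏ i, bumpDensity K ε (S.2 i).1

/-- The law of the sample when both classes are uniform on `[0,1]`. -/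
def uniformSampleMeasure (nmaj nmin : ℕ) : Measure (Sample nmaj nmin) :=
  sampleMeasure nmaj nmin (labelMeasure (fun _ => 1) true) (labelMeasure (fun _ => 1) false)

instance (nmaj nmin : ℕ) : IsProbabilityMeasure (uniformSampleMeasure nmaj nmin) := by
  unfold uniformSampleMeasure; infer_instance

/-- The Bayes classifier when the class `+1` is uniform and the class `-1` has density
`bumpDensity K ε`. -/
def bumpBayes (ε : Fin K → Bool) (x : ℝ) : Bool :=
  if bumpDensity K ε x - 1 ≤ 0 then true else false

lemma measurable_bumpBayes (ε : Fin K → Bool) : Measurable (bumpBayes K ε) :=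
  Measurable.ite (measurableSet_le ((measurable_bumpDensity K ε).sub_const 1)
    measurable_const) measurable_const measurable_const

variable {nmaj nmin : ℕ}

lemma measurable_likelihood (ε : Fin K → Bool) :
    Measurable (likelihood K ε : Sample nmaj nmin → ℝ) :=
  Finset.measurable_fun_prod _ fun i _ => (measurable_bumpDensity K ε).comp (by fun_prop)

lemma likelihood_nonneg (ε : Fin K → Bool) (S : Sample nmaj nmin) : 0 ≤ likelihood K ε S :=
  Finset.prod_nonneg fun _ _ => (bumpDensity_bounds K ε _).1

lemma likelihood_le (ε : Fin K → Bool) (S : Sample nmaj nmin) :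
    likelihood K ε S ≤ 2 ^ nmin := by
  refine (Finset.prod_le_prod (fun _ _ => (bumpDensity_bounds K ε _).1)
    fun _ _ => (bumpDensity_bounds K ε _).2).trans_eq ?_
  simp

lemma integral_likelihood (ε : Fin K → Bool) :
    ∫ S, likelihood K ε S ∂uniformSampleMeasure nmaj nmin = 1 := by
  unfold likelihood uniformSampleMeasure
  rw [integral_prod_sampleMeasure _ _ _ (measurable_bumpDensity K ε), integral_bumpDensity,
    one_pow]

lemma bump_overlap_pos : 0 < 1 - 1 / (8 * Real.pi ^ 2 * (K:ℝ) ^ 3) := by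
  have hK : (1:ℝ) ≤ K := Nat.one_le_cast.mpr (NeZero.pos K)
  have h3 : (1:ℝ) ≤ (K:ℝ) ^ 3 := one_le_pow₀ hK
  have hpi := Real.pi_gt_three
  have : 1 < 8 * Real.pi ^ 2 * (K:ℝ) ^ 3 := by nlinarith
  rw [sub_pos, div_lt_one (by linarith)]
  exact this

lemma le_integral_min_likelihood (ε : Fin K → Bool) (j : Fin K) :
    ((1 - 1 / (8 * Real.pi ^ 2 * (K:ℝ) ^ 3)) ^ nmin) ^ 2 / 2 ≤
      ∫ S, min (likelihood K ε S) (likelihood K (Function.update ε j (!ε j)) S)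
        ∂uniformSampleMeasure nmaj nmin := by
  obtain ⟨r, hrm, hr0, hr, hrint⟩ := exists_sq_le_bumpDensity_mul K ε j
  have hR : ∫ S, ∏ i, r (S.2 i).1 ∂uniformSampleMeasure nmaj nmin =
      (1 - 1 / (8 * Real.pi ^ 2 * (K:ℝ) ^ 3)) ^ nmin := by
    rw [uniformSampleMeasure, integral_prod_sampleMeasure _ _ _ hrm, hrint]
  have hpos := pow_pos (bump_overlap_pos K) nmin
  rw [← hR] at hpos ⊢
  refine half_sq_integral_le_integral_min (integral_likelihood K ε) (integral_likelihood K _)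
    (likelihood_nonneg K ε) (likelihood_nonneg K _) (fun S => ?_)
    (not_imp_comm.mp integral_undef hpos.ne') hpos
  rw [likelihood, likelihood, ← Finset.prod_pow, ← Finset.prod_mul_distrib]
  exact Finset.prod_le_prod (fun _ _ => sq_nonneg _) fun _ _ => hr _

/-- The expected cost of `A` at the point `x`, weighted by the likelihood of the sample. -/
def weightedCost (A : Sample nmaj nmin → ℝ → Bool) (ε : Fin K → Bool) (S : Sample nmaj nmin)
    (x : ℝ) : ℝ :=
  likelihood K ε S *
    ((labelInd (A S x) - labelInd (bumpBayes K ε x)) * (bumpDensity K ε x - 1))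

variable {A : Sample nmaj nmin → ℝ → Bool}

lemma measurable_weightedCost (hA : MeasurableAlg nmaj nmin A) (ε : Fin K → Bool) :
    Measurable fun q : Sample nmaj nmin × ℝ => weightedCost K A ε q.1 q.2 :=
  ((measurable_likelihood K ε).comp measurable_fst).mul
    (((measurable_labelInd.comp hA).sub
      (measurable_labelInd.comp ((measurable_bumpBayes K ε).comp measurable_snd))).mul
      (((measurable_bumpDensity K ε).comp measurable_snd).sub_const 1))

lemma abs_weightedCost_le (ε : Fin K → Bool) (S : Sample nmaj nmin) (x : ℝ) :
    |weightedCost K A ε S x| ≤ 2 ^ nmin := by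
  have h1 : |labelInd (A S x) - labelInd (bumpBayes K ε x)| ≤ 1 :=
    abs_sub_le_of_nonneg_of_le (labelInd_nonneg _) (labelInd_le_one _) (labelInd_nonneg _)
      (labelInd_le_one _)
  have h2 : |bumpDensity K ε x - 1| ≤ 1 :=
    abs_le.mpr ⟨by linarith [(bumpDensity_bounds K ε x).1],
      by linarith [(bumpDensity_bounds K ε x).2]⟩
  rw [weightedCost, abs_mul, abs_mul, abs_of_nonneg (likelihood_nonneg K ε S)]
  exact (mul_le_of_le_one_right (likelihood_nonneg K ε S)
    (mul_le_one₀ h1 (abs_nonneg _) h2)).trans (likelihood_le K ε S)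

lemma integrable_weightedCost (hA : MeasurableAlg nmaj nmin A) (ε : Fin K → Bool) (x : ℝ) :
    Integrable (fun S => weightedCost K A ε S x) (uniformSampleMeasure nmaj nmin) :=
  Integrable.of_bound
    (((measurable_weightedCost K hA ε).comp measurable_prodMk_right).aestronglyMeasurable)
    (2 ^ nmin) (ae_of_all _ fun S => abs_weightedCost_le K ε S x)

lemma integrable_uncurry_weightedCost (hA : MeasurableAlg nmaj nmin A) (ε : Fin K → Bool) :
    Integrable (Function.uncurry (weightedCost K A ε))
      ((uniformSampleMeasure nmaj nmin).prod (volume.restrict (Icc (0:ℝ) 1))) :=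
  Integrable.of_bound (measurable_weightedCost K hA ε).aestronglyMeasurable (2 ^ nmin)
    (ae_of_all _ fun q => abs_weightedCost_le K ε q.1 q.2)

/-- At every point, the two hypotheses that differ only in the bin of `x` cannot both be
cheap. -/
lemma le_integral_weightedCost_add (hA : MeasurableAlg nmaj nmin A) (ε : Fin K → Bool) (x : ℝ) :
    |bump K x| * (((1 - 1 / (8 * Real.pi ^ 2 * (K:ℝ) ^ 3)) ^ nmin) ^ 2 / 2) ≤
      ∫ S, weightedCost K A ε S x ∂uniformSampleMeasure nmaj nmin +
      ∫ S, weightedCost K A (Function.update ε (binIdx K x) (!ε (binIdx K x))) S x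
        ∂uniformSampleMeasure nmaj nmin := by
  set ε' := Function.update ε (binIdx K x) (!ε (binIdx K x)) with hε'
  have hu : bumpDensity K ε x - 1 = sgnB (ε (binIdx K x)) * bump K x := add_sub_cancel_left _ _
  have hu' : bumpDensity K ε' x - 1 = -(sgnB (ε (binIdx K x)) * bump K x) := by
    rw [bumpDensity, add_sub_cancel_left, hε', Function.update_self, sgnB_not, neg_mul]
  have hmin : Integrable (fun S : Sample nmaj nmin => min (likelihood K ε S) (likelihood K ε' S))
      (uniformSampleMeasure nmaj nmin) :=
    (integrable_of_integral_eq_one (integral_likelihood K ε)).inf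
      (integrable_of_integral_eq_one (integral_likelihood K ε'))
  rw [← integral_add (integrable_weightedCost K hA ε x) (integrable_weightedCost K hA ε' x)]
  refine (mul_le_mul_of_nonneg_left (le_integral_min_likelihood (nmaj := nmaj) K ε
    (binIdx K x)) (abs_nonneg _)).trans ?_
  rw [← integral_const_mul]
  refine integral_mono (hmin.const_mul _) ((integrable_weightedCost K hA ε x).add
    (integrable_weightedCost K hA ε' x)) fun S => ?_
  have := abs_mul_min_le (A S x) (sgnB (ε (binIdx K x)) * bump K x)
    (likelihood K ε S) (likelihood K ε' S)
  simp only [weightedCost, bumpBayes, hu, hu']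
  rwa [abs_sgnB_mul_bump] at this

lemma le_sum_integral_weightedCost (hA : MeasurableAlg nmaj nmin A) (x : ℝ) :
    2 ^ K * (((1 - 1 / (8 * Real.pi ^ 2 * (K:ℝ) ^ 3)) ^ nmin) ^ 2 / 4) * |bump K x| ≤
      ∑ ε, ∫ S, weightedCost K A ε S x ∂uniformSampleMeasure nmaj nmin := by
  have h := Finset.sum_le_sum fun (ε : Fin K → Bool) (_ : ε ∈ Finset.univ) =>
    le_integral_weightedCost_add K hA ε x
  rw [Finset.sum_add_distrib, sum_comp_update_not (binIdx K x) (fun ε =>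
    ∫ S, weightedCost K A ε S x ∂uniformSampleMeasure nmaj nmin), Finset.sum_const,
    Finset.card_univ, Fintype.card_fun, Fintype.card_bool, Fintype.card_fin, nsmul_eq_mul] at h
  push_cast at h
  linarith

lemma memLS_bumpDensity (ε : Fin K → Bool) :
    memLS (labelMeasure (fun _ => 1) true) (labelMeasure (bumpDensity K ε) false) :=
  ⟨fun _ => 1, bumpDensity K ε, fun _ => zero_le_one, fun x => (bumpDensity_bounds K ε x).1,
    (LipschitzWith.const' 1).lipschitzOnWith.weaken zero_le_one,
    lipschitzOnWith_bumpDensity K ε, by simp, integral_bumpDensity K ε, rfl, rfl⟩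

lemma integral_weightedCost_le_excessRisk (hA : MeasurableAlg nmaj nmin A)
    (ε : Fin K → Bool) :
    1 / 2 * ∫ x in Icc (0:ℝ) 1, (∫ S, weightedCost K A ε S x ∂uniformSampleMeasure nmaj nmin) ≤
      excessRisk nmaj nmin A (labelMeasure (fun _ => 1) true)
        (labelMeasure (bumpDensity K ε) false) := by
  have hp0 := fun x => (bumpDensity_bounds K ε x).1
  have hm : Measurable fun S : Sample nmaj nmin =>
      ENNReal.ofReal (∏ i, bumpDensity K ε (S.2 i).1) :=
    (measurable_likelihood K ε).ennreal_ofReal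
  refine le_of_eq_of_le ?_ (integral_le_excessRisk hA hp0
    (integral_bumpDensity K ε) (measurable_bumpBayes K ε))
  rw [sampleMeasure_labelMeasure_eq_withDensity nmaj nmin _ (measurable_bumpDensity K ε) hp0
    (integral_bumpDensity K ε), integral_withDensity_eq_integral_toReal_smul
      hm (ae_of_all _ fun S => ENNReal.ofReal_lt_top),
    ← integral_integral_swap (integrable_uncurry_weightedCost K hA ε)]
  congr 1
  refine integral_congr_ae (ae_of_all _ fun S => ?_)
  have := ENNReal.toReal_ofReal (likelihood_nonneg K ε S)
  unfold likelihood at this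
  simp only [weightedCost, likelihood, smul_eq_mul, this]
  rw [integral_const_mul]

lemma le_sum_excessRisk (hA : MeasurableAlg nmaj nmin A) :
    2 ^ K * (((1 - 1 / (8 * Real.pi ^ 2 * (K:ℝ) ^ 3)) ^ nmin) ^ 2 / (32 * Real.pi * K)) ≤
      ∑ ε, excessRisk nmaj nmin A (labelMeasure (fun _ => 1) true)
        (labelMeasure (bumpDensity K ε) false) := by
  have hi : ∀ ε : Fin K → Bool, IntegrableOn
      (fun x => ∫ S, weightedCost K A ε S x ∂uniformSampleMeasure nmaj nmin) (Icc 0 1) :=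
    fun ε => (integrable_uncurry_weightedCost K hA ε).integral_prod_right
  refine le_trans ?_ (Finset.sum_le_sum fun ε _ => integral_weightedCost_le_excessRisk K hA ε)
  rw [← Finset.mul_sum, ← integral_finsetSum _ fun ε _ => hi ε]
  have hmono := integral_mono
    (((continuous_bump K).abs.continuousOn.integrableOn_Icc (a := 0) (b := 1)
      (μ := volume)).const_mul
      (2 ^ K * (((1 - 1 / (8 * Real.pi ^ 2 * (K:ℝ) ^ 3)) ^ nmin) ^ 2 / 4)))
    (integrable_finsetSum _ fun ε _ => hi ε) (le_sum_integral_weightedCost K hA)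
  rw [integral_const_mul] at hmono
  refine le_trans ?_ (mul_le_mul_of_nonneg_left hmono (by norm_num))
  refine le_trans (le_of_eq ?_) (mul_le_mul_of_nonneg_left (mul_le_mul_of_nonneg_left
    (integral_abs_bump_ge K) (by positivity)) (by norm_num))
  have := cast_pos_of_neZero K
  have := Real.pi_pos
  field_simp
  ring

lemma exp_le_bump_overlap_pow (n : ℕ) :
    Real.exp (-(n:ℝ) / (3 * (K:ℝ) ^ 3)) ≤
      ((1 - 1 / (8 * Real.pi ^ 2 * (K:ℝ) ^ 3)) ^ n) ^ 2 := by
  have hK : (1:ℝ) ≤ K := Nat.one_le_cast.mpr (NeZero.pos K)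
  have h3 : (1:ℝ) ≤ (K:ℝ) ^ 3 := one_le_pow₀ hK
  have hpi := Real.pi_gt_three
  have h9 : 9 ≤ Real.pi ^ 2 := by nlinarith
  set y := 1 / (6 * (K:ℝ) ^ 3) with hy
  have hy0 : 0 < y := by positivity
  have hy1 : y ≤ 1 / 6 := one_div_le_one_div_of_le (by norm_num) (by linarith)
  have hxy : 1 / (8 * Real.pi ^ 2 * (K:ℝ) ^ 3) ≤ y / 12 := by
    rw [hy, div_div]
    exact one_div_le_one_div_of_le (by positivity)
      (by nlinarith [mul_le_mul_of_nonneg_right h9 (by positivity : (0:ℝ) ≤ (K:ℝ) ^ 3)])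
  have hbase : Real.exp (-y) ≤ 1 - 1 / (8 * Real.pi ^ 2 * (K:ℝ) ^ 3) := by
    refine le_trans ?_ (sub_le_sub_left hxy 1)
    rw [Real.exp_neg, inv_le_comm₀ (Real.exp_pos _) (by linarith)]
    refine le_trans ?_ (Real.add_one_le_exp y)
    rw [inv_le_comm₀ (by linarith) (by linarith), inv_le_iff_one_le_mul₀ (by linarith)]
    nlinarith
  calc Real.exp (-(n:ℝ) / (3 * (K:ℝ) ^ 3)) = (Real.exp (-y) ^ n) ^ 2 := by
        rw [← pow_mul, ← Real.exp_nat_mul]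
        congr 1
        rw [hy]; push_cast; field_simp; ring
    _ ≤ _ := by gcongr

end Average

/-- **Lemma.** For any positive integer `K`, the minimax excess risk over the label-shift
class `𝒫_LS` is at least `(1/(288K)) exp(-n_min/(3K³))`. -/
theorem label_shift_lower_bound_anyK
    (K nmaj nmin : ℕ) (hK : 0 < K) (hmin : 1 ≤ nmin) (hmaj : nmin < nmaj)
    (A : Sample nmaj nmin → ℝ → Bool) (hA : MeasurableAlg nmaj nmin A) :
    (1/(288*(K:ℝ))) * Real.exp (-(nmin : ℝ)/(3*(K:ℝ)^3)) ≤
      ⨆ P : {P : Measure (ℝ × Bool) × Measure (ℝ × Bool) // memLS P.1 P.2},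
        excessRisk nmaj nmin A P.1.1 P.1.2 := by
  have : NeZero K := ⟨hK.ne'⟩
  have hKpos := cast_pos_of_neZero K
  set B := ⨆ P : {P : Measure (ℝ × Bool) × Measure (ℝ × Bool) // memLS P.1 P.2},
    excessRisk nmaj nmin A P.1.1 P.1.2 with hB
  have hbdd : BddAbove (range fun P : {P : Measure (ℝ × Bool) × Measure (ℝ × Bool) //
      memLS P.1 P.2} => excessRisk nmaj nmin A P.1.1 P.1.2) :=
    ⟨1, by rintro _ ⟨P, rfl⟩; exact excessRisk_le_one A P.2⟩
  have hle : ∀ ε : Fin K → Bool, excessRisk nmaj nmin A (labelMeasure (fun _ => 1) true)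
      (labelMeasure (bumpDensity K ε) false) ≤ B := fun ε =>
    le_ciSup hbdd ⟨(_, _), memLS_bumpDensity K ε⟩
  have hsum := (le_sum_excessRisk K hA).trans (Finset.sum_le_sum fun ε _ => hle ε)
  rw [Finset.sum_const, Finset.card_univ, Fintype.card_fun, Fintype.card_bool,
    Fintype.card_fin, nsmul_eq_mul] at hsum
  push_cast at hsum
  refine le_trans ?_ (le_of_mul_le_mul_left hsum (by positivity))
  rw [one_div_mul_eq_div]
  exact div_le_div₀ (by positivity) (exp_le_bump_overlap_pow K nmin) (by positivity)
    (by nlinarith [Real.pi_lt_four])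
end
end

section
/- For the hard group-shift family with K even: if V is drawn uniformly from {−1,1}^K and S | V=v is drawn from P_{v,maj}^{n_maj} × P_{v,min}^{n_min}, then for every j ∈ {1,…,K/2}, KL( Q(S | v_j = 1) ‖ Q(S | v_j = −1) ) ≤ (n_maj·(2−τ) + n_min·τ)/(3K³), and for every j ∈ {K/2+1,…,K}, KL( Q(S | v_j = 1) ‖ Q(S | v_j = −1) ) ≤ (n_maj·τ + n_min·(2−τ))/(3K³). -/
open MeasureTheory Set
open scoped ENNReal Classical

noncomputable section

section ProductDensity

variable {α : Type*} [MeasurableSpace α]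

lemma pi_withDensity_prod {ι : Type*} [Fintype ι] (μ : Measure α) [IsProbabilityMeasure μ]
    {f : α → ℝ≥0∞} (hf : Measurable f) [IsProbabilityMeasure (μ.withDensity f)] :
    Measure.pi (fun _ : ι => μ.withDensity f) =
      (Measure.pi fun _ : ι => μ).withDensity fun x => ∏ i, f (x i) := by
  refine Measure.pi_eq ?_
  intro s hs
  rw [withDensity_apply _ (MeasurableSet.univ_pi hs),
    ← lintegral_indicator (MeasurableSet.univ_pi hs)]
  have hprod : ∀ x : ι → α, (univ.pi s).indicator (fun x => ∏ i, f (x i)) x =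
      ∏ i, (s i).indicator f (x i) := by
    intro x
    by_cases hx : x ∈ univ.pi s
    · rw [indicator_of_mem hx]
      exact Finset.prod_congr rfl fun i _ => (indicator_of_mem (hx i (mem_univ i)) f).symm
    · rw [indicator_of_notMem hx]
      simp only [mem_pi, mem_univ, true_imp_iff, not_forall] at hx
      obtain ⟨i, hi⟩ := hx
      exact (Finset.prod_eq_zero (Finset.mem_univ i) (indicator_of_notMem hi f)).symm
  have hmeas : ∀ i, Measurable ((s i).indicator f) := fun i => hf.indicator (hs i)
  simp_rw [hprod]
  rw [ProbabilityTheory.lintegral_prod_eq_prod_lintegral_of_indepFun Finset.univ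
    (fun i (x : ι → α) => (s i).indicator f (x i))
    (ProbabilityTheory.iIndepFun_pi fun i => (hmeas i).aemeasurable)
    (fun i => (hmeas i).comp (measurable_pi_apply i))]
  refine Finset.prod_congr rfl fun i _ => ?_
  rw [(measurePreserving_eval (fun _ : ι => μ) i).lintegral_comp (hmeas i),
    lintegral_indicator (hs i), withDensity_apply _ (hs i)]

lemma klDiv'_withDensity (ν : Measure α) [SigmaFinite ν] {r : α → ℝ}
    (hr : Measurable r) (hr0 : ∀ x, 0 ≤ r x) :
    klDiv' (ν.withDensity fun x => ENNReal.ofReal (r x)) ν =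
      ∫ x, Real.log (r x) ∂ν.withDensity fun x => ENNReal.ofReal (r x) := by
  refine integral_congr_ae ?_
  filter_upwards [(withDensity_absolutelyContinuous ν _).ae_le
    (Measure.rnDeriv_withDensity ν hr.ennreal_ofReal)] with x hx
  simp only [hx, ENNReal.toReal_ofReal (hr0 x)]

end ProductDensity

lemma withDensity_finsetSum_measure {α ι : Type*} [MeasurableSpace α] (s : Finset ι)
    (μ : ι → Measure α) (f : α → ℝ≥0∞) :
    (∑ i ∈ s, μ i).withDensity f = ∑ i ∈ s, (μ i).withDensity f := by
  induction s using Finset.cons_induction with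
  | empty => simp
  | cons i s hi ih => rw [Finset.sum_cons, Finset.sum_cons, withDensity_add_measure, ih]

lemma integral_le_of_le {α : Type*} [MeasurableSpace α] {μ : Measure α} {f g : α → ℝ}
    (hfg : ∀ x, f x ≤ g x) (hg : Integrable g μ) (hg0 : 0 ≤ ∫ x, g x ∂μ) :
    ∫ x, f x ∂μ ≤ ∫ x, g x ∂μ := by
  by_cases hf : Integrable f μ
  · exact integral_mono hf hg hfg
  · rwa [integral_undef hf]

section LabelMeasure

lemma integral_labelMeasure {p : ℝ → ℝ} (hp : Measurable p) (hp0 : ∀ x, 0 ≤ p x) (y : Bool)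
    {f : ℝ × Bool → ℝ} (hf : Measurable f) :
    ∫ z, f z ∂labelMeasure p y = ∫ x in Icc (0:ℝ) 1, p x * f (x, y) := by
  rw [labelMeasure, integral_map (by fun_prop) hf.aestronglyMeasurable,
    integral_withDensity_eq_integral_toReal_smul hp.ennreal_ofReal (by simp)]
  simp [ENNReal.toReal_ofReal (hp0 _)]

lemma labelMeasure_mul {p q : ℝ → ℝ} (hp : Measurable p) (hp0 : ∀ x, 0 ≤ p x) (y : Bool)
    {g : ℝ × Bool → ℝ} (hg : Measurable g) (hq : ∀ x, q x = p x * g (x, y)) :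
    labelMeasure q y = (labelMeasure p y).withDensity fun z => ENNReal.ofReal (g z) := by
  have hι : Measurable fun x : ℝ => (x, y) := by fun_prop
  have hgι : Measurable fun x : ℝ => ENNReal.ofReal (g (x, y)) := (hg.comp hι).ennreal_ofReal
  ext s hs
  rw [withDensity_apply _ hs, labelMeasure, labelMeasure, Measure.map_apply hι hs,
    setLIntegral_map hs hg.ennreal_ofReal hι, withDensity_apply _ (hι hs),
    restrict_withDensity (hι hs), lintegral_withDensity_eq_lintegral_mul _ hp.ennreal_ofReal hgι]
  simp [hq, ENNReal.ofReal_mul (hp0 _)]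

lemma labelMeasure_univ (p : ℝ → ℝ) (y : Bool) :
    labelMeasure p y univ = ∫⁻ x in Icc (0:ℝ) 1, ENNReal.ofReal (p x) := by
  rw [labelMeasure, Measure.map_apply (by fun_prop) MeasurableSet.univ]
  simp

lemma covMeasure_univ {p η : ℝ → ℝ} (hp : Measurable p) (hη : Measurable η)
    (hp0 : ∀ x, 0 ≤ p x) (hη01 : ∀ x, η x ∈ Icc (0:ℝ) 1) :
    covMeasure p η univ = ∫⁻ x in Icc (0:ℝ) 1, ENNReal.ofReal (p x) := by
  rw [covMeasure, Measure.add_apply, labelMeasure_univ, labelMeasure_univ,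
    ← lintegral_add_left (by fun_prop)]
  refine lintegral_congr fun x => ?_
  rw [← ENNReal.ofReal_add (mul_nonneg (hp0 x) (hη01 x).1)
    (mul_nonneg (hp0 x) (sub_nonneg.2 (hη01 x).2))]
  ring_nf

lemma covMeasure_withDensity {p η η' : ℝ → ℝ} (hp : Measurable p) (hη : Measurable η)
    (hp0 : ∀ x, 0 ≤ p x) (hη01 : ∀ x, η x ∈ Icc (0:ℝ) 1) {g : ℝ × Bool → ℝ} (hg : Measurable g)
    (htrue : ∀ x, η' x = η x * g (x, true))
    (hfalse : ∀ x, 1 - η' x = (1 - η x) * g (x, false)) :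
    covMeasure p η' = (covMeasure p η).withDensity fun z => ENNReal.ofReal (g z) := by
  rw [covMeasure, covMeasure, withDensity_add_measure]
  congr 1
  · exact labelMeasure_mul (hp.mul hη) (fun x => mul_nonneg (hp0 x) (hη01 x).1) _ hg
      fun x => by rw [htrue, Pi.mul_apply]; ring
  · exact labelMeasure_mul (hp.mul (measurable_const.sub hη))
      (fun x => mul_nonneg (hp0 x) (sub_nonneg.2 (hη01 x).2)) _ hg
      fun x => by rw [hfalse, Pi.mul_apply, Pi.sub_apply]; ring

lemma integral_covMeasure {p η : ℝ → ℝ} (hp : Measurable p) (hη : Measurable η)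
    (hp0 : ∀ x, 0 ≤ p x) (hη01 : ∀ x, η x ∈ Icc (0:ℝ) 1) [IsFiniteMeasure (covMeasure p η)]
    {f : ℝ × Bool → ℝ} (hf : Measurable f) {B C : ℝ} (hpC : ∀ x, p x ≤ C)
    (hfB : ∀ z, |f z| ≤ B) :
    ∫ z, f z ∂covMeasure p η =
      ∫ x in Icc (0:ℝ) 1, p x * (η x * f (x, true) + (1 - η x) * f (x, false)) := by
  have hint : Integrable f (covMeasure p η) :=
    .of_bound hf.aestronglyMeasurable B (.of_forall hfB)
  have hbound : ∀ w : ℝ → ℝ, Measurable w → (∀ x, w x ∈ Icc (0:ℝ) 1) → ∀ y,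
      Integrable (fun x => p x * w x * f (x, y)) (volume.restrict (Icc (0:ℝ) 1)) := by
    intro w hw hw01 y
    refine .of_bound (C := C * 1 * B) (by fun_prop) (.of_forall fun x => ?_)
    rw [norm_mul, norm_mul, Real.norm_eq_abs, Real.norm_eq_abs, Real.norm_eq_abs,
      abs_of_nonneg (hp0 x), abs_of_nonneg (hw01 x).1]
    have := (hp0 x).trans (hpC x)
    have hw0 := (hw01 x).1
    gcongr
    exacts [hpC x, (hw01 x).2, hfB _]
  have h1 : ∀ x, 1 - η x ∈ Icc (0:ℝ) 1 := fun x =>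
    ⟨sub_nonneg.2 (hη01 x).2, by linarith [(hη01 x).1]⟩
  have hsplit := hint
  rw [covMeasure, integrable_add_measure] at hsplit
  rw [covMeasure, integral_add_measure hsplit.1 hsplit.2,
    integral_labelMeasure (p := fun x => p x * η x) (hp.mul hη)
      (fun x => mul_nonneg (hp0 x) (hη01 x).1) _ hf,
    integral_labelMeasure (p := fun x => p x * (1 - η x)) (hp.mul (measurable_const.sub hη))
      (fun x => mul_nonneg (hp0 x) (h1 x).1) _ hf,
    ← integral_add (hbound η hη hη01 true)
      (hbound (fun x => 1 - η x) (measurable_const.sub hη) h1 false)]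
  refine integral_congr_ae (.of_forall fun x => ?_)
  ring

end LabelMeasure

section SampleMeasure

variable {nmaj nmin : ℕ}

lemma sampleMeasure_withDensity (P N : Measure (ℝ × Bool)) [IsProbabilityMeasure P]
    [IsProbabilityMeasure N] {f : ℝ × Bool → ℝ≥0∞} (hf : Measurable f)
    [IsProbabilityMeasure (P.withDensity f)] [IsProbabilityMeasure (N.withDensity f)] :
    sampleMeasure nmaj nmin (P.withDensity f) (N.withDensity f) =
      (sampleMeasure nmaj nmin P N).withDensity
        fun S => (∏ i, f (S.1 i)) * ∏ i, f (S.2 i) := by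
  rw [sampleMeasure, sampleMeasure, pi_withDensity_prod P hf, pi_withDensity_prod N hf,
    prod_withDensity (f := fun x : Fin nmaj → ℝ × Bool => ∏ i, f (x i))
      (g := fun x : Fin nmin → ℝ × Bool => ∏ i, f (x i)) (by fun_prop) (by fun_prop)]

lemma integrable_and_integral_sampleMeasure_sum (P N : Measure (ℝ × Bool)) [IsProbabilityMeasure P]
    [IsProbabilityMeasure N] {f : ℝ × Bool → ℝ} (hP : Integrable f P) (hN : Integrable f N) :
    Integrable (fun S => (∑ i, f (S.1 i)) + ∑ i, f (S.2 i)) (sampleMeasure nmaj nmin P N) ∧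
    ∫ S, ((∑ i, f (S.1 i)) + ∑ i, f (S.2 i)) ∂sampleMeasure nmaj nmin P N =
      nmaj * ∫ z, f z ∂P + nmin * ∫ z, f z ∂N := by
  have hfst (i : Fin nmaj) : MeasurePreserving (fun S : Sample nmaj nmin => S.1 i)
      (sampleMeasure nmaj nmin P N) P :=
    (measurePreserving_eval (fun _ : Fin nmaj => P) i).comp measurePreserving_fst
  have hsnd (i : Fin nmin) : MeasurePreserving (fun S : Sample nmaj nmin => S.2 i)
      (sampleMeasure nmaj nmin P N) N :=
    (measurePreserving_eval (fun _ : Fin nmin => N) i).comp measurePreserving_snd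
  have hifst (i : Fin nmaj) : Integrable (fun S : Sample nmaj nmin => f (S.1 i))
      (sampleMeasure nmaj nmin P N) := (hfst i).integrable_comp_of_integrable hP
  have hisnd (i : Fin nmin) : Integrable (fun S : Sample nmaj nmin => f (S.2 i))
      (sampleMeasure nmaj nmin P N) := (hsnd i).integrable_comp_of_integrable hN
  have hmaj (i : Fin nmaj) : ∫ S : Sample nmaj nmin, f (S.1 i) ∂sampleMeasure nmaj nmin P N =
      ∫ z, f z ∂P := by
    have h := hP.aestronglyMeasurable
    rw [← (hfst i).map_eq] at h
    conv_rhs => rw [← (hfst i).map_eq, integral_map (hfst i).aemeasurable h]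
  have hmin (i : Fin nmin) : ∫ S : Sample nmaj nmin, f (S.2 i) ∂sampleMeasure nmaj nmin P N =
      ∫ z, f z ∂N := by
    have h := hN.aestronglyMeasurable
    rw [← (hsnd i).map_eq] at h
    conv_rhs => rw [← (hsnd i).map_eq, integral_map (hsnd i).aemeasurable h]
  have hsfst := integrable_finsetSum Finset.univ fun i _ => hifst i
  have hssnd := integrable_finsetSum Finset.univ fun i _ => hisnd i
  refine ⟨hsfst.add hssnd, ?_⟩
  rw [integral_add hsfst hssnd, integral_finsetSum _ fun i _ => hifst i,
    integral_finsetSum _ fun i _ => hisnd i]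
  simp [hmaj, hmin]

end SampleMeasure

section HardFamily

lemma measurable_hatFun (K : ℕ) : Measurable (hatFun K) := by
  unfold hatFun
  exact Measurable.ite measurableSet_Icc (by fun_prop)
    (Measurable.ite measurableSet_Icc (by fun_prop) measurable_const)

lemma abs_hatFun_le (K : ℕ) (x : ℝ) : |hatFun K x| ≤ 1 / (4 * (K:ℝ)) := by
  have h2 : 1 / (2 * (K:ℝ)) = 2 * (1 / (4 * (K:ℝ))) := by
    rcases eq_or_ne (K:ℝ) 0 with h | h
    · simp [h]
    · field_simp; norm_num
  have h0 : (0:ℝ) ≤ 1 / (4 * (K:ℝ)) := by positivity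
  unfold hatFun
  rw [h2]
  generalize 1 / (4 * (K:ℝ)) = a at *
  split_ifs with h h'
  · obtain ⟨h, h'⟩ := h
    have : |x + a| ≤ a := abs_le.2 ⟨by linarith, by linarith⟩
    exact abs_le.2 ⟨by linarith [abs_nonneg (x + a)], by linarith⟩
  · obtain ⟨h, h'⟩ := h'
    have : |x - a| ≤ a := abs_le.2 ⟨by linarith, by linarith⟩
    exact abs_le.2 ⟨by linarith, by linarith [abs_nonneg (x - a)]⟩
  · simpa using h0

/-- The bin `I_j = [j/K, (j+1)/K)`. -/
def bin (K : ℕ) (j : Fin K) : Set ℝ := Ico ((j:ℝ)/(K:ℝ)) (((j:ℝ)+1)/(K:ℝ))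

/-- The hat function translated to the center of the bin `I_j` and extended by zero. -/
def binBump (K : ℕ) (j : Fin K) (x : ℝ) : ℝ :=
  if x ∈ bin K j then hatFun K (x - ((j:ℝ) + 1/2)/(K:ℝ)) else 0

lemma measurable_binBump (K : ℕ) (j : Fin K) : Measurable (binBump K j) :=
  Measurable.ite measurableSet_Ico ((measurable_hatFun K).comp (by fun_prop)) measurable_const

lemma abs_binBump_le (K : ℕ) (j : Fin K) (x : ℝ) : |binBump K j x| ≤ 1 / (4 * (K:ℝ)) := by
  unfold binBump
  split_ifs
  · exact abs_hatFun_le K _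
  · simp

lemma abs_binBump_le_quarter (K : ℕ) (j : Fin K) (x : ℝ) : |binBump K j x| ≤ 1 / 4 := by
  have hK : (1:ℝ) ≤ K := by exact_mod_cast (Fin.pos j)
  refine (abs_binBump_le K j x).trans ?_
  gcongr
  linarith

lemma sgnB_eq_or (b : Bool) : sgnB b = 1 ∨ sgnB b = -1 := by cases b <;> simp [sgnB]

lemma abs_sgnB_mul (b : Bool) (t : ℝ) : |sgnB b * t| = |t| := by
  rcases sgnB_eq_or b with h | h <;> simp [h]

lemma hardEta_eq_sum (K : ℕ) (v : Fin K → Bool) (x : ℝ) :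
    hardEta K v x = (1/2) * (1 + ∑ i, sgnB (v i) * binBump K i x) := by
  unfold hardEta
  congr 2
  refine Finset.sum_congr rfl fun i _ => ?_
  by_cases hx : x ∈ bin K i
  · exact (if_pos hx).trans (by rw [binBump, if_pos hx])
  · exact (if_neg hx).trans (by rw [binBump, if_neg hx, mul_zero])

lemma measurable_hardEta (K : ℕ) (v : Fin K → Bool) : Measurable (hardEta K v) := by
  have h := measurable_binBump K
  rw [funext (hardEta_eq_sum K v)]
  fun_prop

lemma eq_of_mem_bin {K : ℕ} {i j : Fin K} {x : ℝ} (hi : x ∈ bin K i) (hj : x ∈ bin K j) :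
    i = j := by
  have hK : (0:ℝ) < K := by exact_mod_cast (Fin.pos j)
  have aux : ∀ {k l : Fin K}, x ∈ bin K k → x ∈ bin K l → (k : ℕ) ≤ l := by
    intro k l hk hl
    have h := hk.1.trans_lt hl.2
    rw [div_lt_div_iff_of_pos_right hK] at h
    exact Nat.lt_succ_iff.1 (by exact_mod_cast h)
  exact Fin.ext (le_antisymm (aux hi hj) (aux hj hi))

lemma hardEta_of_mem_bin {K : ℕ} (v : Fin K → Bool) {j : Fin K} {x : ℝ} (hx : x ∈ bin K j) :
    hardEta K v x = (1/2) * (1 + sgnB (v j) * binBump K j x) := by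
  rw [hardEta_eq_sum, Finset.sum_eq_single j]
  · intro i _ hij
    rw [binBump, if_neg fun hi => hij (eq_of_mem_bin hi hx), mul_zero]
  · simp

lemma hardEta_update_of_notMem_bin {K : ℕ} (v : Fin K → Bool) {j : Fin K} {x : ℝ}
    (hx : x ∉ bin K j) (b : Bool) : hardEta K (Function.update v j b) x = hardEta K v x := by
  rw [hardEta_eq_sum, hardEta_eq_sum]
  congr 2
  refine Finset.sum_congr rfl fun i _ => ?_
  rcases eq_or_ne i j with rfl | hij
  · simp [binBump, hx]
  · rw [Function.update_of_ne hij]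

lemma hardEta_mem_Icc {K : ℕ} (v : Fin K → Bool) (x : ℝ) : hardEta K v x ∈ Icc (0:ℝ) 1 := by
  by_cases hx : ∃ j, x ∈ bin K j
  · obtain ⟨j, hj⟩ := hx
    have h := abs_binBump_le_quarter K j x
    rw [← abs_sgnB_mul (v j), abs_le] at h
    rw [hardEta_of_mem_bin v hj]
    constructor <;> linarith [h.1, h.2]
  · push Not at hx
    rw [hardEta_eq_sum, Finset.sum_eq_zero fun i _ => by rw [binBump, if_neg (hx i), mul_zero]]
    norm_num

/-- The likelihood ratio between `v_j = 1` and `v_j = -1` of one labelled example. -/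
def labelRatio (K : ℕ) (j : Fin K) (z : ℝ × Bool) : ℝ :=
  (1 + sgnB z.2 * binBump K j z.1) / (1 - sgnB z.2 * binBump K j z.1)

lemma measurable_sgnB : Measurable sgnB := measurable_of_countable _

lemma measurable_labelRatio (K : ℕ) (j : Fin K) : Measurable (labelRatio K j) := by
  have h := measurable_binBump K j
  have h' := measurable_sgnB
  unfold labelRatio
  fun_prop

lemma labelRatio_mem_Icc (K : ℕ) (j : Fin K) (z : ℝ × Bool) :
    labelRatio K j z ∈ Icc (1/2 : ℝ) 2 := by
  have h := abs_binBump_le_quarter K j z.1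
  rw [← abs_sgnB_mul z.2, abs_le] at h
  have hpos : 0 < 1 - sgnB z.2 * binBump K j z.1 := by linarith [h.2]
  rw [labelRatio, mem_Icc, le_div_iff₀ hpos, div_le_iff₀ hpos]
  constructor <;> linarith [h.1, h.2]

lemma labelRatio_pos (K : ℕ) (j : Fin K) (z : ℝ × Bool) : 0 < labelRatio K j z :=
  one_half_pos.trans_le (labelRatio_mem_Icc K j z).1

lemma abs_log_labelRatio_le (K : ℕ) (j : Fin K) (z : ℝ × Bool) :
    |Real.log (labelRatio K j z)| ≤ Real.log 2 := by
  obtain ⟨h1, h2⟩ := labelRatio_mem_Icc K j z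
  rw [abs_le]
  constructor
  · rw [← Real.log_inv]
    exact Real.log_le_log (by norm_num) (by linarith)
  · exact Real.log_le_log (labelRatio_pos K j z) h2

lemma labelRatio_of_notMem_bin {K : ℕ} {j : Fin K} {x : ℝ} (hx : x ∉ bin K j) (y : Bool) :
    labelRatio K j (x, y) = 1 := by
  simp [labelRatio, binBump, hx]

lemma hardEta_update_true {K : ℕ} {v : Fin K → Bool} {j : Fin K} (hv : v j = false) (x : ℝ) :
    hardEta K (Function.update v j true) x = hardEta K v x * labelRatio K j (x, true) ∧
      1 - hardEta K (Function.update v j true) x =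
        (1 - hardEta K v x) * labelRatio K j (x, false) := by
  by_cases hx : x ∈ bin K j
  · have h := abs_le.1 (abs_binBump_le_quarter K j x)
    have h1 : 1 - binBump K j x ≠ 0 := by linarith [h.2]
    have h2 : 1 + binBump K j x ≠ 0 := by linarith [h.1]
    rw [hardEta_of_mem_bin _ hx, hardEta_of_mem_bin _ hx]
    constructor <;> simp [labelRatio, hv, sgnB] <;> field_simp <;> ring
  · rw [hardEta_update_of_notMem_bin v hx, labelRatio_of_notMem_bin hx,
      labelRatio_of_notMem_bin hx]
    simp

lemma mul_log_ratio_le {t : ℝ} (ht : |t| ≤ 1/4) :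
    t * Real.log ((1 + t) / (1 - t)) ≤ 8/3 * t ^ 2 := by
  have key : ∀ s : ℝ, 0 ≤ s → s ≤ 1/4 → s * Real.log ((1 + s) / (1 - s)) ≤ 8/3 * s ^ 2 := by
    intro s hs0 hs
    have hpos : 0 < 1 - s := by linarith
    have hlog := Real.log_le_sub_one_of_pos (div_pos (by linarith : 0 < 1 + s) hpos)
    have hle : (1 + s) / (1 - s) - 1 ≤ 8/3 * s := by
      rw [sub_le_iff_le_add, div_le_iff₀ hpos]
      nlinarith
    nlinarith [mul_le_mul_of_nonneg_left (hlog.trans hle) hs0]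
  rcases le_total 0 t with h | h
  · exact key t h (by rwa [abs_of_nonneg h] at ht)
  · have := key (-t) (by linarith) (by rwa [abs_of_nonpos h] at ht)
    rw [sub_neg_eq_add, ← sub_eq_add_neg, ← inv_div (1 + t), Real.log_inv] at this
    linarith

lemma expected_log_labelRatio_le {K : ℕ} {v : Fin K → Bool} {j : Fin K} (hv : v j = true)
    {x : ℝ} (hx : x ∈ bin K j) :
    hardEta K v x * Real.log (labelRatio K j (x, true)) +
      (1 - hardEta K v x) * Real.log (labelRatio K j (x, false)) ≤ 1 / (3 * (K:ℝ) ^ 2) := by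
  have hK : (0:ℝ) < K := by exact_mod_cast (Fin.pos j)
  have hq := abs_binBump_le_quarter K j x
  have hfalse : labelRatio K j (x, false) = (labelRatio K j (x, true))⁻¹ := by
    simp [labelRatio, sgnB, sub_eq_add_neg]
  have hsq : binBump K j x ^ 2 ≤ (1 / (4 * (K:ℝ))) ^ 2 :=
    sq_le_sq' (abs_le.1 (abs_binBump_le K j x)).1 (abs_le.1 (abs_binBump_le K j x)).2
  have hlog := mul_log_ratio_le hq
  have htrue : labelRatio K j (x, true) = (1 + binBump K j x) / (1 - binBump K j x) := by
    simp [labelRatio, sgnB]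
  have hfin : 8/3 * (1 / (4 * (K:ℝ))) ^ 2 ≤ 1 / (3 * (K:ℝ) ^ 2) := by
    have : 8/3 * (1 / (4 * (K:ℝ))) ^ 2 = (1/2) * (1 / (3 * (K:ℝ) ^ 2)) := by
      field_simp; norm_num
    rw [this]
    have : 0 ≤ 1 / (3 * (K:ℝ) ^ 2) := by positivity
    linarith
  rw [hfalse, Real.log_inv, htrue, hardEta_of_mem_bin v hx, hv]
  simp only [sgnB, if_true]
  linarith

lemma measurable_hardPa (t : ℝ) : Measurable (hardPa t) :=
  Measurable.ite measurableSet_Iio measurable_const measurable_const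

lemma hardPa_mem_Icc {t : ℝ} (ht : t ∈ Icc (0:ℝ) 2) (x : ℝ) : hardPa t x ∈ Icc (0:ℝ) 2 := by
  obtain ⟨h0, h2⟩ := ht
  unfold hardPa
  split_ifs <;> constructor <;> linarith

lemma hardPb_eq_hardPa (t : ℝ) : hardPb t = hardPa (2 - t) := by
  funext x
  unfold hardPb hardPa
  split_ifs <;> ring

lemma lintegral_hardPa {t : ℝ} (ht : t ∈ Icc (0:ℝ) 2) :
    ∫⁻ x in Icc (0:ℝ) 1, ENNReal.ofReal (hardPa t x) = 1 := by
  have hlow : Iio (1/2 : ℝ) ∩ Icc 0 1 = Ico 0 (1/2) := by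
    ext x; simp only [mem_inter_iff, mem_Iio, mem_Icc, mem_Ico]
    exact ⟨fun h => ⟨h.2.1, h.1⟩, fun h => ⟨h.2, h.1, by linarith [h.2]⟩⟩
  have hhigh : (Iio (1/2 : ℝ))ᶜ ∩ Icc 0 1 = Icc (1/2) 1 := by
    ext x; simp only [mem_inter_iff, mem_compl_iff, mem_Iio, mem_Icc, not_lt]
    exact ⟨fun h => ⟨h.1, h.2.2⟩, fun h => ⟨h.1, by linarith [h.1], h.2⟩⟩
  have hA : MeasurableSet (Iio (1/2 : ℝ)) := measurableSet_Iio
  rw [← lintegral_add_compl _ hA, Measure.restrict_restrict hA,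
    Measure.restrict_restrict hA.compl, hlow, hhigh,
    setLIntegral_congr_fun (g := fun _ => ENNReal.ofReal (2 - t)) measurableSet_Ico
      (fun x hx => by simp only [hardPa, if_pos hx.2]),
    setLIntegral_congr_fun (g := fun _ => ENNReal.ofReal t) measurableSet_Icc
      (fun x hx => by simp only [hardPa, if_neg (not_lt.2 hx.1)]),
    setLIntegral_const, setLIntegral_const, Real.volume_Ico, Real.volume_Icc,
    ← ENNReal.ofReal_mul (sub_nonneg.2 ht.2), ← ENNReal.ofReal_mul ht.1,
    ← ENNReal.ofReal_add (mul_nonneg (sub_nonneg.2 ht.2) (by norm_num))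
      (mul_nonneg ht.1 (by norm_num)), ← ENNReal.ofReal_one]
  congr 1
  ring

lemma isProbabilityMeasure_covMeasure_hard {K : ℕ} {t : ℝ} (ht : t ∈ Icc (0:ℝ) 2)
    (v : Fin K → Bool) : IsProbabilityMeasure (covMeasure (hardPa t) (hardEta K v)) :=
  ⟨by rw [covMeasure_univ (measurable_hardPa t) (measurable_hardEta K v)
    (fun x => (hardPa_mem_Icc ht x).1) (hardEta_mem_Icc v), lintegral_hardPa ht]⟩

lemma covMeasure_hard_update_true {K : ℕ} {t : ℝ} (ht : t ∈ Icc (0:ℝ) 2) {v : Fin K → Bool}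
    {j : Fin K} (hv : v j = false) :
    covMeasure (hardPa t) (hardEta K (Function.update v j true)) =
      (covMeasure (hardPa t) (hardEta K v)).withDensity
        fun z => ENNReal.ofReal (labelRatio K j z) :=
  covMeasure_withDensity (measurable_hardPa t) (measurable_hardEta K v)
    (fun x => (hardPa_mem_Icc ht x).1) (hardEta_mem_Icc v) (measurable_labelRatio K j)
    (fun x => (hardEta_update_true hv x).1) (fun x => (hardEta_update_true hv x).2)

lemma volume_bin (K : ℕ) (j : Fin K) : volume (bin K j) = ENNReal.ofReal (1 / (K:ℝ)) := by
  rw [bin, Real.volume_Ico]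
  congr 1
  ring

lemma integral_log_labelRatio_le {K : ℕ} {t c : ℝ} (ht : t ∈ Icc (0:ℝ) 2) {v : Fin K → Bool}
    {j : Fin K} (hv : v j = true) (hc0 : 0 ≤ c) (hc : ∀ x ∈ bin K j, hardPa t x = c) :
    ∫ z, Real.log (labelRatio K j z) ∂covMeasure (hardPa t) (hardEta K v) ≤
      c / (3 * (K:ℝ) ^ 3) := by
  have hK : (0:ℝ) < K := by exact_mod_cast (Fin.pos j)
  have := isProbabilityMeasure_covMeasure_hard ht v
  rw [integral_covMeasure (measurable_hardPa t) (measurable_hardEta K v)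
    (fun x => (hardPa_mem_Icc ht x).1) (hardEta_mem_Icc v) (measurable_labelRatio K j).log
    (fun x => (hardPa_mem_Icc ht x).2) (abs_log_labelRatio_le K j)]
  have hbin : MeasurableSet (bin K j) := measurableSet_Ico
  have hle : ∀ x, hardPa t x * (hardEta K v x * Real.log (labelRatio K j (x, true)) +
      (1 - hardEta K v x) * Real.log (labelRatio K j (x, false))) ≤
      (bin K j).indicator (fun _ => c * (1 / (3 * (K:ℝ) ^ 2))) x := by
    intro x
    by_cases hx : x ∈ bin K j
    · rw [indicator_of_mem hx, hc x hx]
      exact mul_le_mul_of_nonneg_left (expected_log_labelRatio_le hv hx) hc0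
    · simp [indicator_of_notMem hx, labelRatio_of_notMem_bin hx]
  have hint : Integrable ((bin K j).indicator fun _ => c * (1 / (3 * (K:ℝ) ^ 2)))
      (volume.restrict (Icc (0:ℝ) 1)) := (integrable_const _).indicator hbin
  have hμ : (volume.restrict (Icc (0:ℝ) 1)).real (bin K j) ≤ 1 / (K:ℝ) := by
    refine ENNReal.toReal_le_of_le_ofReal (by positivity) ?_
    rw [← volume_bin K j]
    exact Measure.restrict_apply_le _ _
  have hnn : 0 ≤ ∫ x, (bin K j).indicator (fun _ => c * (1 / (3 * (K:ℝ) ^ 2))) x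
      ∂volume.restrict (Icc (0:ℝ) 1) :=
    integral_nonneg fun x => indicator_nonneg (fun _ _ => by positivity) x
  refine (integral_le_of_le hle hint hnn).trans ?_
  rw [integral_indicator_const _ hbin, smul_eq_mul]
  calc _ ≤ 1 / (K:ℝ) * (c * (1 / (3 * (K:ℝ) ^ 2))) := by gcongr
    _ = c / (3 * (K:ℝ) ^ 3) := by field_simp

lemma two_sub_mem_Icc {t : ℝ} (ht : t ∈ Icc (0:ℝ) 2) : 2 - t ∈ Icc (0:ℝ) 2 :=
  ⟨sub_nonneg.2 ht.2, by linarith [ht.1]⟩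

variable {K nmaj nmin : ℕ} {t : ℝ} {j : Fin K}

/-- The likelihood ratio between `v_j = 1` and `v_j = -1` of a training sample. -/
def sampleRatio (j : Fin K) (S : Sample nmaj nmin) : ℝ :=
  (∏ i, labelRatio K j (S.1 i)) * ∏ i, labelRatio K j (S.2 i)

lemma measurable_sampleRatio (j : Fin K) :
    Measurable (sampleRatio j : Sample nmaj nmin → ℝ) := by
  have h := measurable_labelRatio K j
  unfold sampleRatio
  fun_prop

lemma sampleRatio_nonneg (j : Fin K) (S : Sample nmaj nmin) : 0 ≤ sampleRatio j S :=
  mul_nonneg (Finset.prod_nonneg fun _ _ => (labelRatio_pos K j _).le)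
    (Finset.prod_nonneg fun _ _ => (labelRatio_pos K j _).le)

lemma log_sampleRatio (j : Fin K) (S : Sample nmaj nmin) :
    Real.log (sampleRatio j S) =
      (∑ i, Real.log (labelRatio K j (S.1 i))) + ∑ i, Real.log (labelRatio K j (S.2 i)) := by
  have h := fun z => (labelRatio_pos K j z).ne'
  rw [sampleRatio, Real.log_mul (Finset.prod_ne_zero_iff.2 fun _ _ => h _)
    (Finset.prod_ne_zero_iff.2 fun _ _ => h _), Real.log_prod fun _ _ => h _,
    Real.log_prod fun _ _ => h _]

lemma isProbabilityMeasure_hardGSMeasure (ht : t ∈ Icc (0:ℝ) 2) (v : Fin K → Bool) :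
    IsProbabilityMeasure (hardGSMeasure K nmaj nmin t v) := by
  have := isProbabilityMeasure_covMeasure_hard ht v
  have := isProbabilityMeasure_covMeasure_hard (two_sub_mem_Icc ht) v
  rw [hardGSMeasure, sampleMeasure, hardPb_eq_hardPa]
  infer_instance

lemma hardGSMeasure_update_true (ht : t ∈ Icc (0:ℝ) 2) {v : Fin K → Bool} (hv : v j = false) :
    hardGSMeasure K nmaj nmin t (Function.update v j true) =
      (hardGSMeasure K nmaj nmin t v).withDensity
        fun S => ENNReal.ofReal (sampleRatio j S) := by
  have ht' := two_sub_mem_Icc ht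
  have h1 := isProbabilityMeasure_covMeasure_hard ht v
  have h2 := isProbabilityMeasure_covMeasure_hard ht' v
  have h3 := isProbabilityMeasure_covMeasure_hard ht (Function.update v j true)
  have h4 := isProbabilityMeasure_covMeasure_hard ht' (Function.update v j true)
  rw [covMeasure_hard_update_true ht hv] at h3
  rw [covMeasure_hard_update_true ht' hv] at h4
  rw [hardGSMeasure, hardGSMeasure, hardPb_eq_hardPa, covMeasure_hard_update_true ht hv,
    covMeasure_hard_update_true ht' hv,
    sampleMeasure_withDensity _ _ (measurable_labelRatio K j).ennreal_ofReal]
  congr 1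
  funext S
  have h := fun z => (labelRatio_pos K j z).le
  rw [sampleRatio, ENNReal.ofReal_mul (Finset.prod_nonneg fun i _ => h _),
    ENNReal.ofReal_prod_of_nonneg fun i _ => h _, ENNReal.ofReal_prod_of_nonneg fun i _ => h _]

lemma sum_filter_true_eq {M : Type*} [AddCommMonoid M] (j : Fin K) (f : (Fin K → Bool) → M) :
    ∑ v with v j = true, f v = ∑ v with v j = false, f (Function.update v j true) := by
  refine Finset.sum_nbij' (fun v => Function.update v j false)
    (fun v => Function.update v j true) (by simp) (by simp) ?_ ?_ ?_
  all_goals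
    intro v hv
    have hv' := (Finset.mem_filter.1 hv).2
    simp [← hv']

lemma condGS_true_eq_withDensity (ht : t ∈ Icc (0:ℝ) 2) (j : Fin K) :
    condGS K nmaj nmin t j true =
      (condGS K nmaj nmin t j false).withDensity
        fun S => ENNReal.ofReal (sampleRatio j S) := by
  have hcard : (Finset.univ.filter fun v : Fin K → Bool => v j = true).card =
      (Finset.univ.filter fun v : Fin K → Bool => v j = false).card := by
    rw [Finset.card_eq_sum_ones, sum_filter_true_eq, Finset.card_eq_sum_ones]
  rw [condGS, condGS, withDensity_smul_measure, withDensity_finsetSum_measure,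
    sum_filter_true_eq, hcard]
  congr 1
  exact Finset.sum_congr rfl fun v hv =>
    hardGSMeasure_update_true ht (Finset.mem_filter.1 hv).2

lemma filter_apply_eq_nonempty (j : Fin K) (b : Bool) :
    (Finset.univ.filter fun v : Fin K → Bool => v j = b).Nonempty :=
  ⟨fun _ => b, by simp⟩

lemma isFiniteMeasure_condGS (ht : t ∈ Icc (0:ℝ) 2) (j : Fin K) (b : Bool) :
    IsFiniteMeasure (condGS K nmaj nmin t j b) := by
  have := isProbabilityMeasure_hardGSMeasure (K := K) (nmaj := nmaj) (nmin := nmin) ht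
  refine Measure.smul_finite _ ?_
  simpa using (filter_apply_eq_nonempty j b).ne_empty

lemma integral_condGS_le (j : Fin K) (b : Bool) {f : Sample nmaj nmin → ℝ} {B : ℝ}
    (hf : ∀ v : Fin K → Bool, v j = b → Integrable f (hardGSMeasure K nmaj nmin t v))
    (hB : ∀ v : Fin K → Bool, v j = b → ∫ S, f S ∂hardGSMeasure K nmaj nmin t v ≤ B) :
    ∫ S, f S ∂condGS K nmaj nmin t j b ≤ B := by
  rw [condGS, integral_smul_measure,
    integral_finsetSum_measure fun v hv => hf v (Finset.mem_filter.1 hv).2]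
  have hcard := Finset.card_pos.2 (filter_apply_eq_nonempty j b)
  have hsum := Finset.sum_le_card_nsmul (Finset.univ.filter fun v : Fin K → Bool => v j = b)
    (fun v => ∫ S, f S ∂hardGSMeasure K nmaj nmin t v) B fun v hv => hB v (Finset.mem_filter.1 hv).2
  rw [nsmul_eq_mul] at hsum
  rw [ENNReal.toReal_inv, ENNReal.toReal_natCast, smul_eq_mul,
    inv_mul_le_iff₀ (by exact_mod_cast hcard)]
  exact hsum

lemma klDiv'_condGS_le (ht : t ∈ Icc (0:ℝ) 2) {c : ℝ} (hc : c ∈ Icc (0:ℝ) 2)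
    (hPa : ∀ x ∈ bin K j, hardPa t x = c) :
    klDiv' (condGS K nmaj nmin t j true) (condGS K nmaj nmin t j false) ≤
      (nmaj * c + nmin * (2 - c)) / (3 * (K:ℝ) ^ 3) := by
  have := isFiniteMeasure_condGS (nmaj := nmaj) (nmin := nmin) ht j false
  rw [condGS_true_eq_withDensity ht j, klDiv'_withDensity _ (measurable_sampleRatio j)
    (sampleRatio_nonneg j), ← condGS_true_eq_withDensity ht j]
  simp_rw [log_sampleRatio]
  have hPb : ∀ x ∈ bin K j, hardPa (2 - t) x = 2 - c := fun x hx => by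
    rw [← hardPb_eq_hardPa, hardPb, hPa x hx]
  have hint : ∀ {s : ℝ}, s ∈ Icc (0:ℝ) 2 → ∀ v : Fin K → Bool,
      Integrable (fun z => Real.log (labelRatio K j z)) (covMeasure (hardPa s) (hardEta K v)) :=
    fun hs v =>
      have := isProbabilityMeasure_covMeasure_hard hs v
      .of_bound (measurable_labelRatio K j).log.aestronglyMeasurable _
        (.of_forall (abs_log_labelRatio_le K j))
  have hmain : ∀ v : Fin K → Bool, _ := fun v =>
    have := isProbabilityMeasure_covMeasure_hard ht v
    have := isProbabilityMeasure_covMeasure_hard (two_sub_mem_Icc ht) v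
    integrable_and_integral_sampleMeasure_sum (nmaj := nmaj) (nmin := nmin) _ _
      (hint ht v) (hint (two_sub_mem_Icc ht) v)
  simp_rw [← hardPb_eq_hardPa] at hmain
  refine integral_condGS_le j true (fun v _ => (hmain v).1) fun v hv => ?_
  refine (hmain v).2.trans_le ?_
  have h1 := integral_log_labelRatio_le ht hv hc.1 hPa
  have h2 := integral_log_labelRatio_le (two_sub_mem_Icc ht) hv (sub_nonneg.2 hc.2) hPb
  rw [← hardPb_eq_hardPa] at h2
  rw [add_div, mul_div_assoc, mul_div_assoc]
  gcongr

lemma bin_subset_Iio_half (hKeven : Even K) (hj : (j : ℕ) < K / 2) : bin K j ⊆ Iio (1/2) := by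
  intro x hx
  have hK : (0:ℝ) < K := by exact_mod_cast (Fin.pos j)
  obtain ⟨m, hm⟩ := hKeven
  have h : (j : ℝ) + 1 ≤ m := by exact_mod_cast (by omega : (j : ℕ) + 1 ≤ m)
  have hm' : (K : ℝ) = m + m := by exact_mod_cast hm
  refine hx.2.trans_le ?_
  rw [div_le_iff₀ hK]
  linarith

lemma bin_subset_Ici_half (hKeven : Even K) (hj : K / 2 ≤ (j : ℕ)) : bin K j ⊆ Ici (1/2) := by
  intro x hx
  have hK : (0:ℝ) < K := by exact_mod_cast (Fin.pos j)
  obtain ⟨m, hm⟩ := hKeven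
  have h : (m : ℝ) ≤ j := by exact_mod_cast (by omega : m ≤ (j : ℕ))
  have hm' : (K : ℝ) = m + m := by exact_mod_cast hm
  refine le_trans ?_ hx.1
  rw [le_div_iff₀ hK]
  linarith

end HardFamily


/-- **Lemma (KL bounds for the hard group-shift family, `K` even).** With `V` uniform on
`{-1,1}^K` and `S | V = v ~ P_{v,maj}^{n_maj} × P_{v,min}^{n_min}`: for every bin index `j`
in the first half (1-based `j ∈ {1,…,K/2}`, i.e. 0-based `(j : ℕ) < K/2`),
`KL(Q(S|v_j=1) ‖ Q(S|v_j=-1)) ≤ (n_maj(2-τ) + n_min τ)/(3K³)`, and for every `j` in the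
second half, `KL(Q(S|v_j=1) ‖ Q(S|v_j=-1)) ≤ (n_maj τ + n_min(2-τ))/(3K³)`. -/
theorem group_shift_kl_bounds
    (K nmaj nmin : ℕ) (hK : 0 < K) (hKeven : Even K) (hmin : 1 ≤ nmin) (hmaj : nmin < nmaj)
    (τ : ℝ) (hτ : τ ∈ Icc (0:ℝ) 1) (j : Fin K) :
    ((j : ℕ) < K/2 →
      klDiv' (condGS K nmaj nmin τ j true) (condGS K nmaj nmin τ j false) ≤
        ((nmaj : ℝ)*(2-τ) + (nmin : ℝ)*τ)/(3*(K:ℝ)^3)) ∧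
    (K/2 ≤ (j : ℕ) →
      klDiv' (condGS K nmaj nmin τ j true) (condGS K nmaj nmin τ j false) ≤
        ((nmaj : ℝ)*τ + (nmin : ℝ)*(2-τ))/(3*(K:ℝ)^3)) := by
  have hτ2 : τ ∈ Icc (0:ℝ) 2 := ⟨hτ.1, by linarith [hτ.2]⟩
  refine ⟨fun hj => ?_, fun hj => ?_⟩
  · have h := klDiv'_condGS_le (nmaj := nmaj) (nmin := nmin) (j := j) hτ2 (two_sub_mem_Icc hτ2)
      fun x hx => if_pos (bin_subset_Iio_half hKeven hj hx)
    rwa [sub_sub_cancel] at h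
  · exact klDiv'_condGS_le hτ2 hτ2
      fun x hx => if_neg (not_lt.2 (bin_subset_Ici_half hKeven hj hx))
end
end
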